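/- Let T > 0 and let (𝓜, u) be a conformal Ricci flow spacetime in the ambient space ℂ × (0,T) which is complete and spatially-connected, i.e. the slice 𝓜_t is connected for every t ∈ (0,T). Then 𝓜 is expanding: for every (z,t) ∈ 𝓜 and every t′ with t ≤ t′ < T, one has (z,t′) ∈ 𝓜. -/

import Mathlib

open Set MeasureTheory Filter Metric

/-- The Euclidean Laplacian of `f : ℂ → ℝ` at `z`, i.e. `∂²f/∂x² + ∂²f/∂y²`. -/
noncomputable def lap (f : ℂ → ℝ) (z : ℂ) : ℝ :=
  iteratedFDeriv ℝ 2 f z ![1, 1] + iteratedFDeriv ℝ 2 f z ![Complex.I, Complex.I]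

/-- The time-timeSlice of a spacetime `M ⊆ ℂ × ℝ` at time `t`. -/
def timeSlice (M : Set (ℂ × ℝ)) (t : ℝ) : Set ℂ := {z | (z, t) ∈ M}

/-- The conformal distance on `Ω` induced by a conformal factor `v`: the infimum of
`v`-lengths of `C¹` paths in `Ω` joining `x` to `y`. -/
noncomputable def confDist (v : ℂ → ℝ) (Ω : Set ℂ) (x y : ℂ) : ℝ :=
  sInf {L : ℝ | ∃ γ : ℝ → ℂ, ContDiffOn ℝ 1 γ (Icc 0 1) ∧
    (∀ s ∈ Icc (0:ℝ) 1, γ s ∈ Ω) ∧ γ 0 = x ∧ γ 1 = y ∧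
    L = ∫ s in (0:ℝ)..1, Real.sqrt (v (γ s)) * ‖derivWithin γ (Icc 0 1) s‖}

/-- The conformal ball of centre `p` and radius `ρ` in `Ω` for the metric `v|dz|²`. -/
def confBall (v : ℂ → ℝ) (Ω : Set ℂ) (p : ℂ) (ρ : ℝ) : Set ℂ :=
  {z ∈ connectedComponentIn Ω p | confDist v Ω p z < ρ}

/-- The conformal metric `v|dz|²` is complete on `Ω`: every connected component of `Ω` is a
complete metric space with respect to the induced distance `confDist v Ω`. -/
def ConfComplete (v : ℂ → ℝ) (Ω : Set ℂ) : Prop :=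
  ∀ x₀ ∈ Ω, ∀ x : ℕ → ℂ, (∀ n, x n ∈ connectedComponentIn Ω x₀) →
    (∀ ε : ℝ, 0 < ε → ∃ N : ℕ, ∀ m ≥ N, ∀ n ≥ N, confDist v Ω (x m) (x n) < ε) →
    ∃ l ∈ connectedComponentIn Ω x₀,
      Tendsto (fun n => confDist v Ω (x n) l) atTop (nhds 0)

/-- A conformal Ricci flow spacetime in the ambient space `ℂ × (0,T)`:
`M` is a connected open subset of `ℂ × (0,T)` with non-empty time-slices, and `u` is a smooth
positive conformal factor on `M` solving the logarithmic fast diffusion equation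
`∂u/∂t = Δ log u`. -/
structure ConfRFS (T : ℝ) (M : Set (ℂ × ℝ)) (u : ℂ → ℝ → ℝ) : Prop where
  sub : M ⊆ {p : ℂ × ℝ | p.2 ∈ Ioo 0 T}
  opn : IsOpen M
  conn : IsConnected M
  nonempty : ∀ t ∈ Ioo (0:ℝ) T, (timeSlice M t).Nonempty
  pos : ∀ p ∈ M, 0 < u p.1 p.2
  smooth : ContDiffOn ℝ (⊤ : ℕ∞) (fun p : ℂ × ℝ => u p.1 p.2) M
  lfde : ∀ p ∈ M, deriv (u p.1) p.2 = lap (fun z => Real.log (u z p.2)) p.1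

/-- A conformal Ricci flow spacetime is complete if the metric `u(·,t)|dz|²` is complete on the
timeSlice `M_t` for every `t ∈ (0,T)`. -/
def ConfRFSComplete (T : ℝ) (M : Set (ℂ × ℝ)) (u : ℂ → ℝ → ℝ) : Prop :=
  ∀ t ∈ Ioo (0:ℝ) T, ConfComplete (fun z => u z t) (timeSlice M t)

/-- There is a time-preserving path in `M` from time `s` to the point `(z,t)`. -/
def TimePreservingFrom (M : Set (ℂ × ℝ)) (s : ℝ) (z : ℂ) (t : ℝ) : Prop :=
  ∃ γ : ℝ → ℂ, ContinuousOn γ (Icc s t) ∧ (∀ r ∈ Icc s t, (γ r, r) ∈ M) ∧ γ t = z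

/-- The hindsight function of a spacetime `M`. -/
noncomputable def hindsight (M : Set (ℂ × ℝ)) (z : ℂ) (t : ℝ) : ℝ :=
  sInf {s : ℝ | 0 < s ∧ s ≤ t ∧ TimePreservingFrom M s z t}

/-- A spacetime is initially determined if its hindsight function vanishes identically. -/
def InitiallyDetermined (M : Set (ℂ × ℝ)) : Prop :=
  ∀ p ∈ M, hindsight M p.1 p.2 = 0

/-- A spacetime in `ℂ × (0,T)` is expanding if worldlines persist until the final time. -/
def Expanding (T : ℝ) (M : Set (ℂ × ℝ)) : Prop :=
  ∀ (z : ℂ) (t t' : ℝ), (z, t) ∈ M → t ≤ t' → t' < T → (z, t') ∈ M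

/-- An expanding spacetime is continuous if each timeSlice is the interior of the intersection of
all later slices. -/
def ContinuousSpacetime (T : ℝ) (M : Set (ℂ × ℝ)) : Prop :=
  ∀ s ∈ Ioo (0:ℝ) T, timeSlice M s = interior (⋂ t ∈ Ioo s T, timeSlice M t)

/-- The vanishing time of the point `(z,t)`: the supremum of the connected component containing
`t` of the set of times at which `z` belongs to the spacetime. -/
noncomputable def vanishTime (M : Set (ℂ × ℝ)) (z : ℂ) (t : ℝ) : ℝ :=
  sSup (connectedComponentIn {r : ℝ | (z, r) ∈ M} t)

/-- `Reach v Ω A r x`: a polygon in `Ω` joins a point of `A` to `x`, and its `v`-length is at most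
`r`, where each edge is measured with an upper bound for `√v` along it. -/
inductive Reach (v : ℂ → ℝ) (Ω A : Set ℂ) : ℝ → ℂ → Prop
  | start {a : ℂ} {r : ℝ} (ha : a ∈ A) (hr : 0 ≤ r) : Reach v Ω A r a
  | step {r r' m : ℝ} {a b : ℂ} (h : Reach v Ω A r a)
      (hseg : ∀ z ∈ segment ℝ a b, z ∈ Ω ∧ √(v z) ≤ m) (hr : r + m * ‖b - a‖ ≤ r') :
      Reach v Ω A r' b

namespace Reach

variable {v : ℂ → ℝ} {Ω A : Set ℂ} {r e : ℝ} {x y : ℂ}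

theorem mono (h : Reach v Ω A r x) {r' : ℝ} (hr : r ≤ r') : Reach v Ω A r' x := by
  cases h with
  | start ha h0 => exact .start ha (h0.trans hr)
  | step h hseg h1 => exact .step h hseg (h1.trans hr)

theorem edge_nonneg {m : ℝ} {a b : ℂ} (hseg : ∀ z ∈ segment ℝ a b, z ∈ Ω ∧ √(v z) ≤ m) :
    0 ≤ m :=
  (Real.sqrt_nonneg _).trans (hseg a (left_mem_segment ℝ a b)).2

theorem nonneg (h : Reach v Ω A r x) : 0 ≤ r := by
  induction h with
  | start _ h => exact h
  | @step r r' m a b _ hseg h1 ih =>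
    have := mul_nonneg (edge_nonneg hseg) (norm_nonneg (b - a))
    exact (add_nonneg ih this).trans h1

theorem mem (hA : A ⊆ Ω) (h : Reach v Ω A r x) : x ∈ Ω := by
  cases h with
  | start ha _ => exact hA ha
  | step _ hseg _ => exact (hseg _ (right_mem_segment ℝ _ _)).1

theorem trans (h : Reach v Ω A r y) (h' : Reach v Ω {y} e x) : Reach v Ω A (r + e) x := by
  induction h' with
  | start ha h0 => rw [mem_singleton_iff] at ha; subst ha; exact h.mono (by linarith)
  | step _ hseg h1 ih => exact .step ih hseg (by linarith)

theorem edge {m : ℝ} {a b : ℂ} (hseg : ∀ z ∈ segment ℝ a b, z ∈ Ω ∧ √(v z) ≤ m) :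
    Reach v Ω {a} (m * ‖b - a‖) b :=
  .step (.start rfl le_rfl) hseg (by linarith)

theorem symm (h : Reach v Ω {x} r y) : Reach v Ω {y} r x := by
  induction h with
  | start ha h0 => rw [mem_singleton_iff] at ha; subst ha; exact .start rfl h0
  | @step r r' m a b _ hseg h1 ih =>
    have : Reach v Ω {b} (m * ‖a - b‖) a := edge (fun z hz => hseg z (segment_symm ℝ b a ▸ hz))
    rw [norm_sub_rev] at this
    exact (this.trans ih).mono (by linarith)

theorem split (h : Reach v Ω A r x) : ∀ s t : ℝ, 0 ≤ s → 0 ≤ t → r ≤ s + t →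
    ∃ y, Reach v Ω A s y ∧ Reach v Ω {y} t x := by
  induction h with
  | @start a _ ha _ => intro s t hs ht _; exact ⟨a, .start ha hs, .start rfl ht⟩
  | @step r r' m a b h hseg h1 ih =>
    intro s t hs ht hst
    have hm := edge_nonneg hseg
    rcases le_or_gt r s with hrs | hrs
    · rcases le_or_gt (m * ‖b - a‖) (s - r) with hl | hl
      · exact ⟨b, .step h hseg (by linarith), .start rfl ht⟩
      · have hpos : 0 < m * ‖b - a‖ := by linarith
        set l := (s - r) / (m * ‖b - a‖) with hldef
        have hl0 : 0 ≤ l := div_nonneg (by linarith) hpos.le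
        have hl1 : l ≤ 1 := (div_le_one hpos).2 hl.le
        have hmul : l * (m * ‖b - a‖) = s - r := div_mul_cancel₀ _ hpos.ne'
        have hy : AffineMap.lineMap a b l ∈ segment ℝ a b := by
          rw [segment_eq_image_lineMap]; exact ⟨l, ⟨hl0, hl1⟩, rfl⟩
        refine ⟨AffineMap.lineMap a b l, .step (m := m) h (fun z hz => hseg z ?_) ?_,
          (edge (m := m) (fun z hz => hseg z ?_)).mono ?_⟩
        · exact (convex_segment a b).segment_subset (left_mem_segment ℝ a b) hy hz
        · have : ‖AffineMap.lineMap a b l - a‖ = l * ‖b - a‖ := by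
            rw [AffineMap.lineMap_apply]; simp [abs_of_nonneg hl0]
          rw [this]; nlinarith
        · exact (convex_segment a b).segment_subset hy (right_mem_segment ℝ a b) hz
        · have : ‖b - AffineMap.lineMap a b l‖ = (1 - l) * ‖b - a‖ := by
            rw [AffineMap.lineMap_apply]
            have : b - (l • (b -ᵥ a) +ᵥ a) = (1 - l) • (b - a) := by
              simp only [vsub_eq_sub, vadd_eq_add, sub_smul, one_smul]; ring
            rw [this, norm_smul, Real.norm_of_nonneg (by linarith)]
          rw [this]; nlinarith
    · obtain ⟨y, h2, h3⟩ := ih s (r - s) hs (by linarith) (by linarith)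
      exact ⟨y, h2, .step h3 hseg (by linarith)⟩

theorem norm_sub_le {c ε : ℝ} (hc : 0 < c) (hv : ∀ z ∈ closedBall y ε, c ≤ √(v z))
    (h : Reach v Ω {y} e x) (he : e ≤ c * ε) : ‖x - y‖ ≤ e / c := by
  induction h with
  | start ha h0 => rw [mem_singleton_iff] at ha; subst ha; simpa using div_nonneg h0 hc.le
  | @step r r' m a b h hseg h1 ih =>
    have hm := edge_nonneg hseg
    have hab := mul_nonneg hm (norm_nonneg (b - a))
    have h2 := ih (by linarith)
    have hcm : c ≤ m := by
      refine (hv a ?_).trans (hseg a (left_mem_segment ℝ a b)).2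
      rw [mem_closedBall_iff_norm]
      refine h2.trans ?_
      rw [div_le_iff₀ hc]; linarith
    have h3 : c * ‖b - a‖ ≤ r' - r := by
      have := mul_le_mul_of_nonneg_right hcm (norm_nonneg (b - a)); linarith
    rw [le_div_iff₀ hc] at h2 ⊢
    have h4 := norm_sub_le_norm_sub_add_norm_sub b a y
    nlinarith

theorem of_mem_ball {m ε : ℝ} (hm : ∀ z ∈ ball y ε, z ∈ Ω ∧ √(v z) ≤ m) (hx : x ∈ ball y ε) :
    Reach v Ω {y} (m * ‖x - y‖) x :=
  edge fun z hz => hm z ((convex_ball y ε).segment_subset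
    (mem_ball_self (dist_nonneg.trans_lt hx)) hx hz)

end Reach

/-- Near a point of `Ω` a continuous positive `v` is bounded above and below. -/
theorem exists_ball_sqrt_bounds {v : ℂ → ℝ} {Ω : Set ℂ} (hΩ : IsOpen Ω) (hv : ContinuousOn v Ω)
    (hpos : ∀ z ∈ Ω, 0 < v z) {y : ℂ} (hy : y ∈ Ω) :
    ∃ ε > 0, ∃ c > 0, ∃ m > 0, ∀ z ∈ closedBall y ε, z ∈ Ω ∧ c ≤ √(v z) ∧ √(v z) ≤ m := by
  obtain ⟨ε, hε, hsub⟩ := Metric.nhds_basis_closedBall.mem_iff.1 (hΩ.mem_nhds hy)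
  have hc : ContinuousOn (fun z => √(v z)) (closedBall y ε) :=
    (hv.mono hsub).sqrt
  have hne : (closedBall y ε).Nonempty := ⟨y, mem_closedBall_self hε.le⟩
  obtain ⟨p, hp, hpm⟩ := (isCompact_closedBall y ε).exists_isMinOn hne hc
  obtain ⟨q, hq, hqm⟩ := (isCompact_closedBall y ε).exists_isMaxOn hne hc
  exact ⟨ε, hε, √(v p), Real.sqrt_pos.2 (hpos p (hsub hp)), √(v q),
    Real.sqrt_pos.2 (hpos q (hsub hq)), fun z hz => ⟨hsub hz, hpm hz, hqm hz⟩⟩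

theorem exists_reach {v : ℂ → ℝ} {Ω : Set ℂ} (hΩ : IsOpen Ω) (hv : ContinuousOn v Ω)
    (hpos : ∀ z ∈ Ω, 0 < v z) (hconn : IsPreconnected Ω) {x y : ℂ} (hx : x ∈ Ω) (hy : y ∈ Ω) :
    ∃ r, Reach v Ω {x} r y := by
  have hA : ({x} : Set ℂ) ⊆ Ω := by simpa using hx
  have hopen : IsOpen {y | ∃ r, Reach v Ω {x} r y} := by
    rw [Metric.isOpen_iff]
    rintro y ⟨r, hr⟩
    obtain ⟨ε, hε, c, hc, m, hm, hb⟩ := exists_ball_sqrt_bounds hΩ hv hpos (hr.mem hA)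
    refine ⟨ε, hε, fun z hz => ⟨_, hr.trans (Reach.of_mem_ball (m := m) (ε := ε) ?_ hz)⟩⟩
    exact fun w hw => ⟨(hb w (ball_subset_closedBall hw)).1, (hb w (ball_subset_closedBall hw)).2.2⟩
  refine hconn.subset_of_closure_inter_subset hopen ⟨x, hx, 0, .start rfl le_rfl⟩ ?_ hy
  rintro y ⟨hyc, hyΩ⟩
  obtain ⟨ε, hε, c, hc, m, hm, hb⟩ := exists_ball_sqrt_bounds hΩ hv hpos hyΩ
  obtain ⟨z, ⟨r, hr⟩, hz⟩ := Metric.mem_closure_iff.1 hyc ε hε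
  have : Reach v Ω {y} (m * ‖z - y‖) z := Reach.of_mem_ball (ε := ε)
    (fun w hw => ⟨(hb w (ball_subset_closedBall hw)).1, (hb w (ball_subset_closedBall hw)).2.2⟩)
    (by rwa [mem_ball, dist_comm])
  exact ⟨_, hr.trans this.symm⟩

/-- A globally `C¹` path in `Ω`, constant outside `[0,1]`, from `x` to `y` with `v`-length at
most `L`. -/
def PathLe (v : ℂ → ℝ) (Ω : Set ℂ) (x y : ℂ) (L : ℝ) : Prop :=
  ∃ γ : ℝ → ℂ, ContDiff ℝ 1 γ ∧ (∀ s, γ s ∈ Ω) ∧ (∀ s ≤ 0, γ s = x) ∧ (∀ s ≥ 1, γ s = y) ∧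
    ∫ s in (0:ℝ)..1, √(v (γ s)) * ‖deriv γ s‖ ≤ L

theorem PathLe.trans {v : ℂ → ℝ} {Ω : Set ℂ} (hv : ContinuousOn v Ω) {x y z : ℂ} {L L' : ℝ}
    (h : PathLe v Ω x y L) (h' : PathLe v Ω y z L') : PathLe v Ω x z (L + L') := by
  obtain ⟨γ, hγ, hγΩ, hγ0, hγ1, hγL⟩ := h
  obtain ⟨η, hη, hηΩ, hη0, hη1, hηL⟩ := h'
  set κ : ℝ → ℂ := fun s => γ (2 * s) + η (2 * s - 1) - y with hκ
  have hleft : ∀ s ≤ 1 / 2, κ s = γ (2 * s) := fun s hs => by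
    simp only [hκ]; rw [hη0 (2 * s - 1) (by linarith)]; ring
  have hright : ∀ s ≥ 1 / 2, κ s = η (2 * s - 1) := fun s hs => by
    simp only [hκ]; rw [hγ1 (2 * s) (by linarith)]; ring
  have hdγ : ∀ s, DifferentiableAt ℝ γ s := fun s => hγ.differentiable (by norm_num) s
  have hdη : ∀ s, DifferentiableAt ℝ η s := fun s => hη.differentiable (by norm_num) s
  have hdκ : ∀ s, deriv κ s = (2:ℝ) • deriv γ (2 * s) + (2:ℝ) • deriv η (2 * s - 1) := by
    intro s
    have h1 : HasDerivAt (fun s : ℝ => 2 * s) 2 s := by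
      simpa using (hasDerivAt_id s).const_mul (2:ℝ)
    have h2 : HasDerivAt (fun s : ℝ => 2 * s - 1) 2 s := h1.sub_const 1
    exact (((hdγ _).hasDerivAt.scomp s h1).add ((hdη _).hasDerivAt.scomp s h2)
      |>.sub_const y).deriv
  have hγ' : ∀ s > 1, deriv γ s = 0 := fun s hs => by
    have : γ =ᶠ[nhds s] fun _ => y := by
      filter_upwards [lt_mem_nhds hs] with w hw using hγ1 w hw.le
    rw [this.deriv_eq, deriv_const]
  have hη' : ∀ s < 0, deriv η s = 0 := fun s hs => by
    have : η =ᶠ[nhds s] fun _ => y := by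
      filter_upwards [gt_mem_nhds hs] with w hw using hη0 w hw.le
    rw [this.deriv_eq, deriv_const]
  have hint : ∀ ξ : ℝ → ℂ, ContDiff ℝ 1 ξ → (∀ s, ξ s ∈ Ω) →
      Continuous (fun s => √(v (ξ s)) * ‖deriv ξ s‖) := fun ξ hξ hξΩ =>
    (hv.comp_continuous hξ.continuous hξΩ).sqrt.mul (hξ.continuous_deriv le_rfl).norm
  have hκC : ContDiff ℝ 1 κ := by
    refine ((hγ.comp (contDiff_const.mul contDiff_id)).add
      (hη.comp ((contDiff_const.mul contDiff_id).sub contDiff_const))).sub contDiff_const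
  have hκΩ : ∀ s, κ s ∈ Ω := fun s => by
    rcases le_total s (1 / 2) with hs | hs
    · rw [hleft s hs]; exact hγΩ _
    · rw [hright s hs]; exact hηΩ _
  refine ⟨κ, hκC, hκΩ, fun s hs => ?_, fun s hs => ?_, ?_⟩
  · rw [hleft s (by linarith), hγ0 _ (by linarith)]
  · rw [hright s (by linarith), hη1 _ (by linarith)]
  have hi := fun a b => (hint κ hκC hκΩ).intervalIntegrable (μ := volume) a b
  rw [← intervalIntegral.integral_add_adjacent_intervals (hi 0 (1 / 2)) (hi (1 / 2) 1)]
  have e1 : ∫ s in (0:ℝ)..(1/2), √(v (κ s)) * ‖deriv κ s‖ =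
      ∫ s in (0:ℝ)..1, √(v (γ s)) * ‖deriv γ s‖ := by
    have := intervalIntegral.mul_integral_comp_mul_left (a := 0) (b := 1 / 2)
      (f := fun s => √(v (γ s)) * ‖deriv γ s‖) (2:ℝ)
    norm_num at this
    rw [← this, ← intervalIntegral.integral_const_mul]
    refine intervalIntegral.integral_congr_ae ?_
    have hae : ∀ᵐ s : ℝ, s ≠ 1 / 2 := by simp [ae_iff]
    filter_upwards [hae] with s hs1 hs
    rw [uIoc_of_le (by norm_num)] at hs
    rw [hleft s hs.2, hdκ, hη' _ (by have := lt_of_le_of_ne hs.2 hs1; linarith)]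
    simp; ring
  have e2 : ∫ s in (1/2:ℝ)..1, √(v (κ s)) * ‖deriv κ s‖ =
      ∫ s in (0:ℝ)..1, √(v (η s)) * ‖deriv η s‖ := by
    have := intervalIntegral.mul_integral_comp_mul_sub (a := 1 / 2) (b := 1)
      (f := fun s => √(v (η s)) * ‖deriv η s‖) (2:ℝ) 1
    norm_num at this
    rw [← this, ← intervalIntegral.integral_const_mul]
    refine intervalIntegral.integral_congr_ae ?_
    filter_upwards with s hs
    rw [uIoc_of_le (by norm_num)] at hs
    rw [hright s hs.1.le, hdκ, hγ' _ (by linarith [hs.1])]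
    simp; ring
  rw [e1, e2]; linarith

theorem pathLe_segment {v : ℂ → ℝ} {Ω : Set ℂ} (hv : ContinuousOn v Ω) {a b : ℂ} {m : ℝ}
    (hseg : ∀ z ∈ segment ℝ a b, z ∈ Ω ∧ √(v z) ≤ m) : PathLe v Ω a b (m * ‖b - a‖) := by
  set σ := Real.smoothTransition with hσ
  have hσC : ContDiff ℝ 1 σ := Real.smoothTransition.contDiff
  set γ : ℝ → ℂ := fun s => a + σ s • (b - a) with hγdef
  have hγC : ContDiff ℝ 1 γ := contDiff_const.add (hσC.smul contDiff_const)
  have hmem : ∀ s, γ s ∈ segment ℝ a b := fun s => by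
    rw [segment_eq_image']
    exact ⟨σ s, ⟨Real.smoothTransition.nonneg s, Real.smoothTransition.le_one s⟩, rfl⟩
  have hdσ : ∀ s, HasDerivAt σ (deriv σ s) s := fun s =>
    (hσC.differentiable (by norm_num) s).hasDerivAt
  have hγd : ∀ s, deriv γ s = deriv σ s • (b - a) := fun s =>
    (((hdσ s).smul_const (b - a)).const_add a).deriv
  have hmono : ∀ s, 0 ≤ deriv σ s := fun s => (Real.smoothTransition.monotone).deriv_nonneg
  refine ⟨γ, hγC, fun s => (hseg _ (hmem s)).1, fun s hs => ?_, fun s hs => ?_, ?_⟩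
  · simp [hγdef, hσ, Real.smoothTransition.zero_of_nonpos hs]
  · simp [hγdef, hσ, Real.smoothTransition.one_of_one_le hs]
  have hσ' : Continuous (deriv σ) := hσC.continuous_deriv le_rfl
  calc ∫ s in (0:ℝ)..1, √(v (γ s)) * ‖deriv γ s‖
      ≤ ∫ s in (0:ℝ)..1, (m * ‖b - a‖) * deriv σ s := by
        refine intervalIntegral.integral_mono_on (by norm_num) ?_ ?_ fun s _ => ?_
        · exact ((hv.comp_continuous hγC.continuous fun s => (hseg _ (hmem s)).1).sqrt.mul
            (hγC.continuous_deriv le_rfl).norm).intervalIntegrable _ _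
        · exact (continuous_const.mul hσ').intervalIntegrable _ _
        · rw [hγd, norm_smul, Real.norm_of_nonneg (hmono s)]
          have := mul_le_mul_of_nonneg_right (hseg _ (hmem s)).2
            (mul_nonneg (norm_nonneg (b - a)) (hmono s))
          nlinarith
    _ = m * ‖b - a‖ := by
        rw [intervalIntegral.integral_const_mul, intervalIntegral.integral_eq_sub_of_hasDerivAt
          (fun s _ => hdσ s) (hσ'.intervalIntegrable _ _)]
        simp [hσ]

theorem Reach.pathLe {v : ℂ → ℝ} {Ω : Set ℂ} (hv : ContinuousOn v Ω) {x y : ℂ} (hx : x ∈ Ω)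
    {r : ℝ} (h : Reach v Ω {x} r y) : PathLe v Ω x y r := by
  induction h with
  | start ha h0 =>
    rw [mem_singleton_iff] at ha; subst ha
    exact ⟨fun _ => _, contDiff_const, fun _ => hx, fun _ _ => rfl, fun _ _ => rfl, by simpa⟩
  | step h hseg h1 ih =>
    obtain ⟨γ, h1', h2, h3, h4, h5⟩ := ih.trans hv (pathLe_segment hv hseg)
    exact ⟨γ, h1', h2, h3, h4, h5.trans h1⟩

theorem bddBelow_lengths (v : ℂ → ℝ) (Ω : Set ℂ) (x y : ℂ) :
    BddBelow {L : ℝ | ∃ γ : ℝ → ℂ, ContDiffOn ℝ 1 γ (Icc 0 1) ∧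
      (∀ s ∈ Icc (0:ℝ) 1, γ s ∈ Ω) ∧ γ 0 = x ∧ γ 1 = y ∧
      L = ∫ s in (0:ℝ)..1, √(v (γ s)) * ‖derivWithin γ (Icc 0 1) s‖} := by
  refine ⟨0, ?_⟩
  rintro L ⟨γ, -, -, -, -, rfl⟩
  exact intervalIntegral.integral_nonneg (by norm_num) fun s _ => by positivity

theorem Reach.exists_length_le {v : ℂ → ℝ} {Ω : Set ℂ} (hv : ContinuousOn v Ω) {x y : ℂ}
    (hx : x ∈ Ω) {r : ℝ} (h : Reach v Ω {x} r y) :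
    ∃ L ∈ {L : ℝ | ∃ γ : ℝ → ℂ, ContDiffOn ℝ 1 γ (Icc 0 1) ∧
      (∀ s ∈ Icc (0:ℝ) 1, γ s ∈ Ω) ∧ γ 0 = x ∧ γ 1 = y ∧
      L = ∫ s in (0:ℝ)..1, √(v (γ s)) * ‖derivWithin γ (Icc 0 1) s‖}, L ≤ r := by
  obtain ⟨γ, h1, h2, h3, h4, h5⟩ := h.pathLe hv hx
  refine ⟨_, ⟨γ, h1.contDiffOn, fun s _ => h2 s, h3 0 le_rfl, h4 1 le_rfl, rfl⟩, ?_⟩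
  refine le_of_eq_of_le (intervalIntegral.integral_congr fun s hs => ?_) h5
  rw [uIcc_of_le (by norm_num)] at hs
  rw [(h1.differentiable (by norm_num) s).derivWithin (uniqueDiffOn_Icc (by norm_num) s hs)]

theorem Reach.confDist_le {v : ℂ → ℝ} {Ω : Set ℂ} (hv : ContinuousOn v Ω) {x y : ℂ}
    (hx : x ∈ Ω) {r : ℝ} (h : Reach v Ω {x} r y) : confDist v Ω x y ≤ r := by
  obtain ⟨L, hL, hLr⟩ := h.exists_length_le hv hx
  exact (csInf_le (bddBelow_lengths v Ω x y) hL).trans hLr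

/-- The length of a path ending at the centre of a ball on which `√v ≥ c`. -/
theorem mul_le_length {v : ℂ → ℝ} {Ω : Set ℂ} (hv : ContinuousOn v Ω) {γ : ℝ → ℂ} {ρ c : ℝ}
    (hc : 0 ≤ c) (hb : ∀ z ∈ closedBall (γ 1) ρ, c ≤ √(v z))
    (hγ : ContDiffOn ℝ 1 γ (Icc 0 1)) (hΩ : ∀ s ∈ Icc (0:ℝ) 1, γ s ∈ Ω)
    (h0 : ρ ≤ ‖γ 0 - γ 1‖) :
    c * ρ ≤ ∫ s in (0:ℝ)..1, √(v (γ s)) * ‖derivWithin γ (Icc 0 1) s‖ := by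
  have hcont := hγ.continuousOn
  set S := {s ∈ Icc (0:ℝ) 1 | ρ ≤ ‖γ s - γ 1‖} with hS
  have hSne : S.Nonempty := ⟨0, ⟨le_rfl, by norm_num⟩, h0⟩
  have hSc : IsClosed S := by
    have := (hcont.sub (continuousOn_const (c := γ 1))).norm.preimage_isClosed_of_isClosed
      isClosed_Icc (isClosed_Ici (a := ρ))
    exact this
  have hSb : BddAbove S := ⟨1, fun s hs => hs.1.2⟩
  have hs0 := hSc.csSup_mem hSne hSb
  set s0 := sSup S
  have hin : ∀ s ∈ Ioc s0 1, c ≤ √(v (γ s)) := fun s hs => by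
    refine hb _ ?_
    rw [mem_closedBall_iff_norm]
    by_contra hcon
    push Not at hcon
    exact absurd (le_csSup hSb ⟨⟨hs0.1.1.trans hs.1.le, hs.2⟩, hcon.le⟩) (not_le.2 hs.1)
  have hd : ContinuousOn (derivWithin γ (Icc 0 1)) (Icc 0 1) :=
    hγ.continuousOn_derivWithin (uniqueDiffOn_Icc (by norm_num)) le_rfl
  have hfc : ContinuousOn (fun s => √(v (γ s)) * ‖derivWithin γ (Icc 0 1) s‖) (Icc 0 1) :=
    (hv.comp hcont hΩ).sqrt.mul hd.norm
  have hsub : Icc s0 1 ⊆ Icc 0 1 := Icc_subset_Icc_left hs0.1.1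
  have hFTC : ∫ s in s0..1, derivWithin γ (Icc 0 1) s = γ 1 - γ s0 := by
    refine intervalIntegral.integral_eq_sub_of_hasDeriv_right_of_le hs0.1.2 (hcont.mono hsub)
      (fun s hs => ?_) ?_
    · have hs' : s ∈ Ioo (0:ℝ) 1 := ⟨hs0.1.1.trans_lt hs.1, hs.2⟩
      have := (hγ.differentiableOn (by norm_num) s (Ioo_subset_Icc_self hs')).hasDerivWithinAt
      exact (this.hasDerivAt (Icc_mem_nhds hs'.1 hs'.2)).hasDerivWithinAt
    · exact (hd.mono (by rw [uIcc_of_le hs0.1.2]; exact hsub)).intervalIntegrable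
  have hI1 : IntervalIntegrable (fun s => √(v (γ s)) * ‖derivWithin γ (Icc 0 1) s‖) volume 0 s0 :=
    (hfc.mono (by rw [uIcc_of_le hs0.1.1]; exact Icc_subset_Icc_right hs0.1.2)).intervalIntegrable
  have hI2 : IntervalIntegrable (fun s => √(v (γ s)) * ‖derivWithin γ (Icc 0 1) s‖) volume s0 1 :=
    (hfc.mono (by rw [uIcc_of_le hs0.1.2]; exact hsub)).intervalIntegrable
  rw [← intervalIntegral.integral_add_adjacent_intervals hI1 hI2]
  have hn1 : 0 ≤ ∫ s in (0:ℝ)..s0, √(v (γ s)) * ‖derivWithin γ (Icc 0 1) s‖ :=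
    intervalIntegral.integral_nonneg hs0.1.1 fun s _ => by positivity
  have hdI : IntervalIntegrable (fun s => ‖derivWithin γ (Icc 0 1) s‖) volume s0 1 :=
    (hd.norm.mono (by rw [uIcc_of_le hs0.1.2]; exact hsub)).intervalIntegrable
  have h3 : ∫ s in s0..1, c * ‖derivWithin γ (Icc 0 1) s‖ ≤
      ∫ s in s0..1, √(v (γ s)) * ‖derivWithin γ (Icc 0 1) s‖ := by
    refine intervalIntegral.integral_mono_on_of_le_Ioo hs0.1.2 (hdI.const_mul c) hI2 fun s hs => ?_
    exact mul_le_mul_of_nonneg_right (hin s ⟨hs.1, hs.2.le⟩) (norm_nonneg _)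
  rw [intervalIntegral.integral_const_mul] at h3
  have h4 : ρ ≤ ∫ s in s0..1, ‖derivWithin γ (Icc 0 1) s‖ := by
    have := intervalIntegral.norm_integral_le_integral_norm (μ := volume)
      (f := derivWithin γ (Icc 0 1)) hs0.1.2
    rw [hFTC, norm_sub_rev] at this
    exact hs0.2.trans this
  nlinarith [mul_le_mul_of_nonneg_left h4 hc]

/-- Completeness in terms of polygons: a sequence which is Cauchy for the polygonal distance
converges in `Ω`. -/
theorem ConfComplete.exists_tendsto {v : ℂ → ℝ} {Ω : Set ℂ} (hcomp : ConfComplete v Ω)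
    (hΩ : IsOpen Ω) (hv : ContinuousOn v Ω) (hpos : ∀ z ∈ Ω, 0 < v z) (hconn : IsConnected Ω)
    {x : ℕ → ℂ} (hx : ∀ n, x n ∈ Ω)
    (hC : ∀ ε > 0, ∃ N, ∀ m ≥ N, ∀ n ≥ N, ∃ r < ε, Reach v Ω {x m} r (x n)) :
    ∃ l ∈ Ω, Tendsto x atTop (nhds l) := by
  obtain ⟨x₀, hx₀⟩ := hconn.nonempty
  have hcc : connectedComponentIn Ω x₀ = Ω := hconn.isPreconnected.connectedComponentIn hx₀
  obtain ⟨l, hl, hlim⟩ := hcomp x₀ hx₀ x (fun n => by rw [hcc]; exact hx n) fun ε hε => by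
    obtain ⟨N, hN⟩ := hC ε hε
    refine ⟨N, fun m hm n hn => ?_⟩
    obtain ⟨r, hr, h⟩ := hN m hm n hn
    exact (h.confDist_le hv (hx m)).trans_lt hr
  rw [hcc] at hl
  refine ⟨l, hl, ?_⟩
  obtain ⟨ε, hε, c, hc, m, hm, hb⟩ := exists_ball_sqrt_bounds hΩ hv hpos hl
  rw [Metric.tendsto_atTop]
  intro δ hδ
  set ρ := min δ ε with hρ
  have hρ0 : 0 < ρ := lt_min hδ hε
  obtain ⟨N, hN⟩ := Metric.tendsto_atTop.1 hlim (c * ρ) (mul_pos hc hρ0)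
  refine ⟨N, fun n hn => ?_⟩
  by_contra hcon
  push Not at hcon
  have h1 : confDist v Ω (x n) l < c * ρ := by
    have := hN n hn
    rw [Real.dist_0_eq_abs] at this
    exact (le_abs_self _).trans_lt this
  obtain ⟨r, hr⟩ := exists_reach hΩ hv hpos hconn.isPreconnected (hx n) hl
  obtain ⟨L0, hL0, -⟩ := hr.exists_length_le hv (hx n)
  obtain ⟨L, ⟨γ, hγ, hγΩ, h0, h1', rfl⟩, hlt⟩ := exists_lt_of_csInf_lt ⟨L0, hL0⟩ h1
  refine absurd (mul_le_length hv hc.le (fun z hz => ?_) hγ hγΩ ?_) (not_le.2 hlt)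
  · rw [h1'] at hz
    exact (hb z (closedBall_subset_closedBall (min_le_right _ _) hz)).2.1
  · rw [h0, h1', ← dist_eq_norm]; exact (min_le_left _ _).trans hcon

theorem exists_compact_reach_of_approx {v : ℂ → ℝ} {Ω : Set ℂ} (hcomp : ConfComplete v Ω)
    (hΩ : IsOpen Ω) (hv : ContinuousOn v Ω) (hpos : ∀ z ∈ Ω, 0 < v z) (hconn : IsConnected Ω)
    {A : Set ℂ} {R : ℝ}
    (h : ∀ ε > 0, ∃ r ≥ 0, R ≤ r + ε ∧ ∃ C, IsCompact C ∧ C ⊆ Ω ∧ ∀ x, Reach v Ω A r x → x ∈ C) :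
    ∃ C, IsCompact C ∧ C ⊆ Ω ∧ ∀ x, Reach v Ω A R x → x ∈ C := by
  set S := {x | Reach v Ω A R x} with hS
  have hcover : ∀ ε > 0, ∃ t : Finset ℂ, (∀ y ∈ t, y ∈ Ω) ∧
      ∀ x ∈ S, ∃ y ∈ t, Reach v Ω {y} ε x := by
    intro ε hε
    obtain ⟨r, hr0, hr, C, hC, hCΩ, hrC⟩ := h (ε / 2) (by linarith)
    have hnhds : ∀ y ∈ C, {z | Reach v Ω {y} (ε / 2) z} ∈ nhds y := by
      intro y hy
      obtain ⟨ρ, hρ, c, hc, m, hm, hb⟩ := exists_ball_sqrt_bounds hΩ hv hpos (hCΩ hy)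
      refine Filter.mem_of_superset (ball_mem_nhds y (lt_min hρ (div_pos (half_pos hε) hm))) ?_
      intro z hz
      have hz1 := ball_subset_ball (min_le_left _ _) hz
      have hz2 := ball_subset_ball (min_le_right _ _) hz
      refine (Reach.of_mem_ball (m := m) (ε := ρ) (fun w hw =>
        have := hb w (ball_subset_closedBall hw); ⟨this.1, this.2.2⟩) hz1).mono ?_
      rw [mem_ball_iff_norm, lt_div_iff₀ hm] at hz2
      linarith
    obtain ⟨t, htC, ht⟩ := hC.elim_nhds_subcover _ hnhds
    refine ⟨t, fun y hy => hCΩ (htC y hy), fun x hx => ?_⟩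
    obtain ⟨y, hy1, hy2⟩ := Reach.split hx r (ε / 2) hr0 (by linarith) hr
    obtain ⟨w, hw, hwy⟩ := mem_iUnion₂.1 (ht (hrC y hy1))
    exact ⟨w, hw, (Reach.trans hwy hy2).mono (by linarith)⟩
  have hconv : ∀ f : Ultrafilter ℂ, S ∈ f → ∃ l ∈ Ω, (f : Filter ℂ) ≤ nhds l := by
    intro f hf
    have hball : ∀ n : ℕ, ∃ y ∈ Ω, {x | Reach v Ω {y} ((1 / 2 : ℝ) ^ n) x} ∈ f := by
      intro n
      obtain ⟨t, htΩ, ht⟩ := hcover ((1 / 2) ^ n) (by positivity)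
      have : ⋃ y ∈ (t : Set ℂ), {x | Reach v Ω {y} ((1 / 2 : ℝ) ^ n) x} ∈ f := by
        refine Filter.mem_of_superset hf fun x hx => ?_
        obtain ⟨y, hy, hyx⟩ := ht x hx
        exact mem_iUnion₂.2 ⟨y, hy, hyx⟩
      obtain ⟨y, hy, hyf⟩ := (Ultrafilter.finite_biUnion_mem_iff t.finite_toSet).1 this
      exact ⟨y, htΩ y hy, hyf⟩
    choose c hcΩ hcf using hball
    have hpow : Tendsto (fun n : ℕ => (1 / 2 : ℝ) ^ n) atTop (nhds 0) :=
      tendsto_pow_atTop_nhds_zero_of_lt_one (by norm_num) (by norm_num)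
    obtain ⟨l, hl, hlim⟩ := hcomp.exists_tendsto hΩ hv hpos hconn hcΩ (by
      intro ε hε
      obtain ⟨N, hN⟩ := Filter.eventually_atTop.1 (hpow.eventually (gt_mem_nhds (half_pos hε)))
      refine ⟨N, fun m hm n hn => ?_⟩
      obtain ⟨x, hx1, hx2⟩ := f.nonempty_of_mem (Filter.inter_mem (hcf m) (hcf n))
      exact ⟨_, by linarith [hN m hm, hN n hn], Reach.trans hx1 hx2.symm⟩)
    refine ⟨l, hl, ?_⟩
    obtain ⟨ε, hε, a, ha, m, hm, hb⟩ := exists_ball_sqrt_bounds hΩ hv hpos hl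
    rw [Metric.nhds_basis_ball.ge_iff]
    intro δ hδ
    set ρ := min δ ε / 2 with hρ
    have hρ0 : 0 < ρ := half_pos (lt_min hδ hε)
    obtain ⟨n, hn1, hn2⟩ := ((hpow.eventually (gt_mem_nhds (mul_pos ha hρ0))).and
      (hlim.eventually (ball_mem_nhds l hρ0))).exists
    refine Filter.mem_of_superset (hcf n) fun x hx => ?_
    have hsub : closedBall (c n) ρ ⊆ closedBall l ε := by
      refine closedBall_subset_closedBall' ?_
      have := min_le_right δ ε
      linarith [mem_ball.1 hn2]
    have := Reach.norm_sub_le ha (fun z hz => (hb z (hsub hz)).2.1) hx hn1.le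
    have h2 : ‖x - c n‖ < ρ := this.trans_lt (by rw [div_lt_iff₀ ha]; linarith)
    rw [mem_ball]
    have h3 := dist_triangle x (c n) l
    rw [← dist_eq_norm] at h2
    have := min_le_left δ ε
    linarith [mem_ball.1 hn2]
  refine ⟨closure S, Metric.isCompact_of_isClosed_isBounded isClosed_closure ?_, ?_,
    fun x hx => subset_closure hx⟩
  · refine Bornology.IsBounded.closure ?_
    by_contra hcon
    have hne : NeBot (Bornology.cobounded ℂ ⊓ 𝓟 S) := by
      rw [neBot_iff, Ne, ← disjoint_iff]
      intro hd
      apply hcon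
      rw [Bornology.isBounded_def]
      exact (Filter.disjoint_principal_right.1 hd)
    obtain ⟨l, -, hl⟩ := hconv (Ultrafilter.of (Bornology.cobounded ℂ ⊓ 𝓟 S))
      (Ultrafilter.of_le _ (Filter.mem_inf_of_right (mem_principal_self S)))
    have h1 : ((Ultrafilter.of (Bornology.cobounded ℂ ⊓ 𝓟 S) : Ultrafilter ℂ) : Filter ℂ) ≤
      Bornology.cobounded ℂ := (Ultrafilter.of_le _).trans inf_le_left
    have h2 := (Metric.disjoint_nhds_cobounded l).mono hl h1
    exact (Ultrafilter.neBot _).ne (disjoint_self.1 h2)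
  · intro x hx
    obtain ⟨f, hf, hfx⟩ := mem_closure_iff_ultrafilter.1 hx
    obtain ⟨l, hl, hfl⟩ := hconv f hf
    rwa [tendsto_nhds_unique' f.neBot (f := id) hfx hfl]

/-- Hopf–Rinow: in a complete metric, points at bounded distance from a compact set stay in a
compact set. -/
theorem exists_compact_reach {v : ℂ → ℝ} {Ω : Set ℂ} (hcomp : ConfComplete v Ω)
    (hΩ : IsOpen Ω) (hv : ContinuousOn v Ω) (hpos : ∀ z ∈ Ω, 0 < v z) (hconn : IsConnected Ω)
    {A : Set ℂ} (hA : IsCompact A) (hAΩ : A ⊆ Ω) (R : ℝ) :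
    ∃ C, IsCompact C ∧ C ⊆ Ω ∧ ∀ x, Reach v Ω A R x → x ∈ C := by
  rcases lt_or_ge R 0 with hR | hR
  · exact ⟨∅, isCompact_empty, empty_subset _, fun x hx => absurd hx.nonneg (not_le.2 hR)⟩
  set G : Set ℝ := {r | ∃ C, IsCompact C ∧ C ⊆ Ω ∧ ∀ x, Reach v Ω A r x → x ∈ C} with hG
  have hclosed : IsClosed (G ∩ Icc 0 R) := by
    refine isClosed_of_closure_subset fun r hr => ?_
    have hrI : r ∈ Icc 0 R := closure_minimal inter_subset_right isClosed_Icc hr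
    refine ⟨exists_compact_reach_of_approx hcomp hΩ hv hpos hconn fun ε hε => ?_, hrI⟩
    obtain ⟨s, hs, hsr⟩ := Metric.mem_closure_iff.1 hr ε hε
    refine ⟨s, hs.2.1, ?_, hs.1⟩
    rw [Real.dist_eq] at hsr
    linarith [(abs_lt.1 hsr).2]
  have h0 : (0:ℝ) ∈ G := by
    refine ⟨A, hA, hAΩ, fun x hx => ?_⟩
    have key : ∀ r x, Reach v Ω A r x → r ≤ 0 → x ∈ A := by
      intro r x h
      induction h with
      | start ha _ => exact fun _ => ha
      | @step r r' m a b h hseg h1 ih =>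
        intro hr'
        have hmem := hseg a (left_mem_segment ℝ a b)
        have hm : 0 < m := (Real.sqrt_pos.2 (hpos a hmem.1)).trans_le hmem.2
        have h2 := mul_nonneg hm.le (norm_nonneg (b - a))
        have h3 := h.nonneg
        have h4 : ‖b - a‖ = 0 := by
          have : m * ‖b - a‖ = 0 := by linarith
          simpa [hm.ne'] using this
        rw [norm_eq_zero, sub_eq_zero] at h4
        rw [h4]; exact ih (by linarith)
    exact key 0 x hx le_rfl
  refine hclosed.Icc_subset_of_forall_exists_gt h0 (fun r hr s hs => ?_) ⟨hR, le_rfl⟩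
  obtain ⟨⟨C, hC, hCΩ, hrC⟩, hr0, -⟩ := hr
  obtain ⟨ε, hε, hεΩ⟩ := hC.exists_cthickening_subset_open hΩ hCΩ
  have hCε : IsCompact (cthickening ε C) := hC.cthickening
  obtain ⟨c, hc, hcv⟩ : ∃ c > 0, ∀ z ∈ cthickening ε C, c ≤ √(v z) := by
    rcases (cthickening ε C).eq_empty_or_nonempty with he | hne
    · exact ⟨1, one_pos, fun z hz => by simp [he] at hz⟩
    · obtain ⟨p, hp, hpm⟩ := hCε.exists_isMinOn hne ((hv.mono hεΩ).sqrt)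
      exact ⟨√(v p), Real.sqrt_pos.2 (hpos p (hεΩ hp)), fun z hz => hpm hz⟩
  refine ⟨min s (r + c * ε), ⟨cthickening ε C, hCε, hεΩ, fun x hx => ?_⟩, ?_, min_le_left _ _⟩
  · obtain ⟨y, hy, hyx⟩ := Reach.split hx r (c * ε) hr0 (by positivity) (min_le_right _ _)
    have hyC := hrC y hy
    have := Reach.norm_sub_le hc (ε := ε)
      (fun z hz => hcv z (closedBall_subset_cthickening hyC ε hz)) hyx le_rfl
    rw [mul_div_cancel_left₀ _ hc.ne'] at this
    exact closedBall_subset_cthickening hyC ε (mem_closedBall_iff_norm.2 this)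
  · exact lt_min hs (by have := mul_pos hc hε; linarith)

/-- Comparison of polygonal distances for two conformal factors `v₀, v` which are comparable on a
thickening of a set containing a metric ball of `v₀`. -/
theorem Reach.of_comparable {v v₀ : ℂ → ℝ} {Ω Ω₀ A C : Set ℂ} {ε q R : ℝ} (hε : 0 < ε)
    (hq : 0 ≤ q) (hC : ∀ x, Reach v₀ Ω₀ A (q * R) x → x ∈ C)
    (hcomp : ∀ z ∈ cthickening ε C, z ∈ Ω₀ ∧ √(v₀ z) ≤ q * √(v z)) {r : ℝ} {x : ℂ}
    (h : Reach v Ω A r x) (hr : r ≤ R) : Reach v₀ Ω₀ A (q * r) x := by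
  induction h with
  | start ha h0 => exact .start ha (mul_nonneg hq h0)
  | @step r r' m a b h hseg h1 ih =>
    have hm := Reach.edge_nonneg hseg
    have hmab := mul_nonneg hm (norm_nonneg (b - a))
    have h0 := ih (by linarith)
    obtain ⟨n, hn⟩ := exists_nat_gt (‖b - a‖ / ε)
    have hn0 : (0:ℝ) < n := (div_nonneg (norm_nonneg _) hε.le).trans_lt hn
    have hnε : ‖b - a‖ / n ≤ ε := by
      rw [div_lt_iff₀ hε] at hn
      rw [div_le_iff₀ hn0]; linarith
    have hpt : ∀ j : ℕ, j ≤ n → AffineMap.lineMap a b ((j:ℝ) / n) ∈ segment ℝ a b := by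
      intro j hj
      rw [segment_eq_image_lineMap]
      exact ⟨_, ⟨by positivity, (div_le_one hn0).2 (by exact_mod_cast hj)⟩, rfl⟩
    have key : ∀ j : ℕ, j ≤ n →
        Reach v₀ Ω₀ A (q * (r + m * ‖b - a‖ * (j / n))) (AffineMap.lineMap a b ((j:ℝ) / n)) := by
      intro j
      induction j with
      | zero => intro _; simpa using h0
      | succ j ihj =>
        intro hj
        have hj' := ihj (by omega)
        have hle : q * (r + m * ‖b - a‖ * (j / n)) ≤ q * R := by
          refine mul_le_mul_of_nonneg_left ?_ hq
          have : (j:ℝ) / n ≤ 1 := (div_le_one hn0).2 (by exact_mod_cast (by omega : j ≤ n))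
          nlinarith
        have hjC := hC _ (hj'.mono hle)
        have hdiff : ‖AffineMap.lineMap a b (((j + 1 : ℕ):ℝ) / n) -
            AffineMap.lineMap a b ((j:ℝ) / n)‖ = ‖b - a‖ / n := by
          rw [AffineMap.lineMap_apply, AffineMap.lineMap_apply]
          have : ((((j + 1 : ℕ):ℝ) / n) • (b -ᵥ a) +ᵥ a) - (((j:ℝ) / n) • (b -ᵥ a) +ᵥ a) =
              ((1:ℝ) / n) • (b - a) := by
            have : (((j + 1 : ℕ):ℝ) / n) = (j:ℝ) / n + 1 / n := by push_cast; ring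
            rw [this, add_smul]
            simp only [vsub_eq_sub, vadd_eq_add]
            ring
          rw [this, norm_smul, Real.norm_of_nonneg (by positivity)]; ring
        refine .step (m := q * m) hj' (fun z hz => ?_) ?_
        · have hz1 : z ∈ segment ℝ a b :=
            (convex_segment a b).segment_subset (hpt j (by omega)) (hpt (j + 1) hj) hz
          have hz2 : z ∈ closedBall (AffineMap.lineMap a b ((j:ℝ) / n) : ℂ) ε := by
            refine (convex_closedBall _ _).segment_subset (mem_closedBall_self hε.le) ?_ hz
            rw [mem_closedBall_iff_norm, hdiff]; exact hnε
          obtain ⟨hz3, hz4⟩ := hcomp z (closedBall_subset_cthickening hjC ε hz2)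
          exact ⟨hz3, hz4.trans (mul_le_mul_of_nonneg_left (hseg z hz1).2 hq)⟩
        · rw [hdiff]; push_cast; apply le_of_eq; ring
    have hlast := key n le_rfl
    rw [div_self hn0.ne', AffineMap.lineMap_apply_one, mul_one] at hlast
    exact hlast.mono (mul_le_mul_of_nonneg_left h1 hq)

/-- In a complete spacetime, the points at bounded distance from a compact set `D` persisting over
`[a,b]` stay in a compact subset of the spacetime. -/
theorem exists_compact_reach_slab {M : Set (ℂ × ℝ)} {u : ℂ → ℝ → ℝ} (hM : IsOpen M)
    (hu : ContinuousOn (fun p : ℂ × ℝ => u p.1 p.2) M) (hpos : ∀ p ∈ M, 0 < u p.1 p.2)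
    {D : Set ℂ} (hD : IsCompact D) {a b : ℝ} (hDM : ∀ z ∈ D, ∀ t ∈ Icc a b, (z, t) ∈ M)
    (hcomp : ∀ t ∈ Icc a b, ConfComplete (fun z => u z t) (timeSlice M t))
    (hconn : ∀ t ∈ Icc a b, IsConnected (timeSlice M t)) (R : ℝ) :
    ∃ K ⊆ M, IsCompact K ∧ ∀ t ∈ Icc a b, ∀ x,
      Reach (fun z => u z t) (timeSlice M t) D R x → (x, t) ∈ K := by
  rcases lt_or_ge R 0 with hR | hR
  · exact ⟨∅, empty_subset _, isCompact_empty,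
      fun t _ x hx => absurd hx.nonneg (not_le.2 hR)⟩
  suffices h : ∃ K ⊆ M, IsCompact K ∧ ∀ t ∈ Icc a b, t ∈ Icc a b → ∀ x,
      Reach (fun z => u z t) (timeSlice M t) D R x → (x, t) ∈ K by
    obtain ⟨K, h1, h2, h3⟩ := h
    exact ⟨K, h1, h2, fun t ht => h3 t ht ht⟩
  refine (isCompact_Icc (a := a) (b := b)).induction_on (p := fun I => ∃ K ⊆ M, IsCompact K ∧
    ∀ t ∈ I, t ∈ Icc a b → ∀ x,
      Reach (fun z => u z t) (timeSlice M t) D R x → (x, t) ∈ K) ?_ ?_ ?_ ?_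
  · exact ⟨∅, empty_subset _, isCompact_empty, fun t ht => absurd ht (notMem_empty t)⟩
  · rintro I J hIJ ⟨K, h1, h2, h3⟩
    exact ⟨K, h1, h2, fun t ht => h3 t (hIJ ht)⟩
  · rintro I J ⟨K, h1, h2, h3⟩ ⟨K', h1', h2', h3'⟩
    refine ⟨K ∪ K', union_subset h1 h1', h2.union h2', fun t ht htI x hx => ?_⟩
    rcases ht with ht | ht
    · exact Or.inl (h3 t ht htI x hx)
    · exact Or.inr (h3' t ht htI x hx)
  intro t₀ ht₀
  have hslice : ∀ t : ℝ, Continuous fun z : ℂ => (z, t) := fun t => by fun_prop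
  have hopen : IsOpen (timeSlice M t₀) := hM.preimage (hslice t₀)
  have hcont : ContinuousOn (fun z => u z t₀) (timeSlice M t₀) :=
    hu.comp (hslice t₀).continuousOn fun z hz => hz
  obtain ⟨C, hC, hCΩ, hRC⟩ := exists_compact_reach (hcomp t₀ ht₀) hopen hcont
    (fun z hz => hpos (z, t₀) hz) (hconn t₀ ht₀) hD (fun z hz => hDM z hz t₀ ht₀) (R + 1)
  obtain ⟨ε, hε, hεΩ⟩ := hC.exists_cthickening_subset_open hopen hCΩ
  have hCε : IsCompact (cthickening ε C) := hC.cthickening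
  set q := 1 + 1 / (R + 1) with hq
  have hq1 : 1 < q := by rw [hq]; have : 0 < 1 / (R + 1) := by positivity
                         linarith
  have hqR : q * R ≤ R + 1 := by
    have : R / (R + 1) ≤ 1 := (div_le_one (by linarith)).2 (by linarith)
    calc q * R = R + R / (R + 1) := by rw [hq]; ring
      _ ≤ _ := by linarith
  have hev : ∀ᶠ t in nhds t₀, ∀ z ∈ cthickening ε C,
      (z, t) ∈ M ∧ √(u z t₀) < q * √(u z t) := by
    refine hCε.eventually_forall_of_forall_eventually fun z hz => ?_
    have hzM : (z, t₀) ∈ M := hεΩ hz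
    have hc1 : ContinuousAt (fun p : ℝ × ℂ => u p.2 p.1) (t₀, z) :=
      ContinuousAt.comp (f := fun p : ℝ × ℂ => (p.2, p.1)) (x := (t₀, z))
        (hu.continuousAt (hM.mem_nhds hzM)) (by fun_prop)
    have hc2 : ContinuousAt (fun p : ℝ × ℂ => u p.2 t₀) (t₀, z) :=
      ContinuousAt.comp (f := fun p : ℝ × ℂ => (p.2, t₀)) (x := (t₀, z))
        (hu.continuousAt (hM.mem_nhds hzM)) (by fun_prop)
    have hmem : ∀ᶠ p : ℝ × ℂ in nhds (t₀, z), (p.2, p.1) ∈ M :=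
      (show ContinuousAt (fun p : ℝ × ℂ => (p.2, p.1)) (t₀, z) by fun_prop).eventually
        (hM.mem_nhds hzM)
    refine hmem.and (hc2.sqrt.eventually_lt (hc1.sqrt.const_mul q) ?_)
    have := Real.sqrt_pos.2 (hpos _ hzM)
    simp only at this ⊢
    nlinarith
  obtain ⟨δ, hδ, hδb⟩ := Metric.nhds_basis_closedBall.eventually_iff.1 hev
  refine ⟨closedBall t₀ δ, mem_nhdsWithin_of_mem_nhds (closedBall_mem_nhds _ hδ),
    C ×ˢ closedBall t₀ δ, ?_, hC.prod (isCompact_closedBall _ _), fun t ht _ x hx => ⟨?_, ht⟩⟩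
  · rintro ⟨z, t⟩ ⟨hz, ht⟩
    exact (hδb ht z (self_subset_cthickening C hz)).1
  · have hRC' : ∀ x, Reach (fun z => u z t₀) (timeSlice M t₀) D (q * R) x → x ∈ C :=
      fun x hx => hRC x (hx.mono hqR)
    exact hRC' x (Reach.of_comparable hε (by linarith) hRC'
      (fun z hz => ⟨hεΩ hz, (hδb ht z hz).2.le⟩) hx le_rfl)

/-- The directional derivative of `f` in the direction `w`. -/
noncomputable def dirDeriv {E : Type*} [NormedAddCommGroup E] [NormedSpace ℝ E] (f : E → ℝ) (w : E)
    (p : E) : ℝ := fderiv ℝ f p w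

section dirDeriv

variable {E : Type*} [NormedAddCommGroup E] [NormedSpace ℝ E] {f g : E → ℝ} {M : Set E} {p : E}

theorem ContDiffOn.dirDeriv (hM : IsOpen M) (hf : ContDiffOn ℝ (⊤ : ℕ∞) f M) (w : E) :
    ContDiffOn ℝ (⊤ : ℕ∞) (dirDeriv f w) M :=
  (hf.fderiv_of_isOpen hM (by simp)).clm_apply contDiffOn_const

theorem ContDiffOn.hasFDerivAt_of_isOpen (hM : IsOpen M) (hf : ContDiffOn ℝ (⊤ : ℕ∞) f M)
    (hp : p ∈ M) : HasFDerivAt f (fderiv ℝ f p) p :=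
  ((hf.contDiffAt (hM.mem_nhds hp)).differentiableAt (by simp)).hasFDerivAt

theorem ContDiffOn.hasDerivAt_line (hM : IsOpen M) (hf : ContDiffOn ℝ (⊤ : ℕ∞) f M) (w : E) {s : ℝ}
    (hp : p + s • w ∈ M) :
    HasDerivAt (fun l : ℝ => f (p + l • w)) (_root_.dirDeriv f w (p + s • w)) s := by
  have h1 : HasDerivAt (fun l : ℝ => p + l • w) w s := by
    simpa using ((hasDerivAt_id s).smul_const w).const_add p
  exact (hf.hasFDerivAt_of_isOpen hM hp).comp_hasDerivAt s h1

theorem dirDeriv_congr (hM : IsOpen M) (hfg : ∀ p ∈ M, f p = g p) (hp : p ∈ M) (w : E) :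
    dirDeriv f w p = dirDeriv g w p := by
  have : f =ᶠ[nhds p] g := Filter.eventually_of_mem (hM.mem_nhds hp) hfg
  rw [dirDeriv, this.fderiv_eq, dirDeriv]

theorem dirDeriv_add_dir (f : E → ℝ) (v w : E) :
    dirDeriv f (v + w) = fun p => dirDeriv f v p + dirDeriv f w p := by
  ext p; simp [dirDeriv]

theorem dirDeriv_smul_dir (f : E → ℝ) (c : ℝ) (w : E) :
    dirDeriv f (c • w) = fun p => c * dirDeriv f w p := by
  ext p; simp [dirDeriv]

theorem dirDeriv_add (hM : IsOpen M) (hf : ContDiffOn ℝ (⊤ : ℕ∞) f M)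
    (hg : ContDiffOn ℝ (⊤ : ℕ∞) g M) (hp : p ∈ M) (w : E) :
    dirDeriv (fun q => f q + g q) w p = dirDeriv f w p + dirDeriv g w p := by
  rw [dirDeriv, ((hf.hasFDerivAt_of_isOpen hM hp).fun_add (hg.hasFDerivAt_of_isOpen hM hp)).fderiv]
  rfl

theorem dirDeriv_const_mul (hM : IsOpen M) (hf : ContDiffOn ℝ (⊤ : ℕ∞) f M) (hp : p ∈ M) (c : ℝ)
    (w : E) : dirDeriv (fun q => c * f q) w p = c * dirDeriv f w p := by
  rw [dirDeriv, ((hf.hasFDerivAt_of_isOpen hM hp).const_mul c).fderiv]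
  rfl

theorem dirDeriv_mul (hM : IsOpen M) (hf : ContDiffOn ℝ (⊤ : ℕ∞) f M)
    (hg : ContDiffOn ℝ (⊤ : ℕ∞) g M) (hp : p ∈ M) (w : E) :
    dirDeriv (fun q => f q * g q) w p = f p * dirDeriv g w p + g p * dirDeriv f w p := by
  rw [dirDeriv, ((hf.hasFDerivAt_of_isOpen hM hp).fun_mul (hg.hasFDerivAt_of_isOpen hM hp)).fderiv]
  rfl

theorem dirDeriv_dirDeriv (hM : IsOpen M) (hf : ContDiffOn ℝ (⊤ : ℕ∞) f M) (hp : p ∈ M) (v w : E) :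
    dirDeriv (dirDeriv f v) w p = fderiv ℝ (fderiv ℝ f) p w v := by
  have h : DifferentiableAt ℝ (fderiv ℝ f) p :=
    ((hf.fderiv_of_isOpen (m := (⊤ : ℕ∞)) hM (by simp)).contDiffAt
      (hM.mem_nhds hp)).differentiableAt (by simp)
  have := h.hasFDerivAt.clm_apply (hasFDerivAt_const v p)
  change fderiv ℝ (fun q => fderiv ℝ f q v) p w = _
  rw [this.fderiv]; simp

theorem dirDeriv_comm (hM : IsOpen M) (hf : ContDiffOn ℝ (⊤ : ℕ∞) f M) (hp : p ∈ M) (v w : E) :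
    dirDeriv (dirDeriv f v) w p = dirDeriv (dirDeriv f w) v p := by
  rw [dirDeriv_dirDeriv hM hf hp, dirDeriv_dirDeriv hM hf hp]
  exact (hf.contDiffAt (hM.mem_nhds hp)).isSymmSndFDerivAt
    (by simpa using
      (by exact_mod_cast le_top : ((2 : ℕ∞) : WithTop ℕ∞) ≤ ((⊤ : ℕ∞) : WithTop ℕ∞))) w v

end dirDeriv

/-- The spatial Laplacian of a function on spacetime. -/
noncomputable def spaceLap (f : ℂ × ℝ → ℝ) (p : ℂ × ℝ) : ℝ :=
  dirDeriv (dirDeriv f (1, 0)) (1, 0) p + dirDeriv (dirDeriv f (Complex.I, 0)) (Complex.I, 0) p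

section spacetime

variable {M : Set (ℂ × ℝ)} {f : ℂ × ℝ → ℝ} {p : ℂ × ℝ}

theorem dirDeriv_complex (f : ℂ × ℝ → ℝ) (w : ℂ) (p : ℂ × ℝ) :
    dirDeriv f (w, 0) p = w.re * dirDeriv f (1, 0) p + w.im * dirDeriv f (Complex.I, 0) p := by
  have : ((w, 0) : ℂ × ℝ) = w.re • (1, 0) + w.im • (Complex.I, 0) := by
    ext <;> simp
  rw [this, dirDeriv_add_dir, dirDeriv_smul_dir, dirDeriv_smul_dir]

theorem dirDeriv_dirDeriv_complex (hM : IsOpen M) (hf : ContDiffOn ℝ (⊤ : ℕ∞) f M) (hp : p ∈ M)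
    (w : ℂ) : dirDeriv (dirDeriv f (w, 0)) (w, 0) p =
      w.re ^ 2 * dirDeriv (dirDeriv f (1, 0)) (1, 0) p +
      2 * (w.re * w.im) * dirDeriv (dirDeriv f (1, 0)) (Complex.I, 0) p +
      w.im ^ 2 * dirDeriv (dirDeriv f (Complex.I, 0)) (Complex.I, 0) p := by
  have h1 := hf.dirDeriv hM (1, 0)
  have h2 := hf.dirDeriv hM (Complex.I, 0)
  have : dirDeriv f (w, 0) = fun p => w.re * dirDeriv f (1, 0) p +
      w.im * dirDeriv f (Complex.I, 0) p := funext (dirDeriv_complex f w)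
  rw [this, dirDeriv_add hM (contDiffOn_const.mul h1) (contDiffOn_const.mul h2) hp,
    dirDeriv_const_mul hM h1 hp, dirDeriv_const_mul hM h2 hp, dirDeriv_complex _ w,
    dirDeriv_complex (dirDeriv f (Complex.I, 0)) w, dirDeriv_comm hM hf hp (Complex.I, 0) (1, 0)]
  ring

theorem dirDeriv_dirDeriv_rotate (hM : IsOpen M) (hf : ContDiffOn ℝ (⊤ : ℕ∞) f M) (hp : p ∈ M)
    (w : ℂ) : dirDeriv (dirDeriv f (w, 0)) (w, 0) p +
      dirDeriv (dirDeriv f (Complex.I * w, 0)) (Complex.I * w, 0) p = ‖w‖ ^ 2 * spaceLap f p := by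
  rw [dirDeriv_dirDeriv_complex hM hf hp w, dirDeriv_dirDeriv_complex hM hf hp (Complex.I * w),
    spaceLap,
    Complex.sq_norm, Complex.normSq_apply]
  simp
  ring

theorem lap_slice_eq_spaceLap (hM : IsOpen M) (hf : ContDiffOn ℝ (⊤ : ℕ∞) f M) {z : ℂ} {t : ℝ}
    (hp : (z, t) ∈ M) : lap (fun z => f (z, t)) z = spaceLap f (z, t) := by
  have hslice : Continuous fun z : ℂ => (z, t) := by fun_prop
  have hΩ : IsOpen ((fun z : ℂ => (z, t)) ⁻¹' M) := hM.preimage hslice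
  have hder : ∀ g : ℂ × ℝ → ℝ, ContDiffOn ℝ (⊤ : ℕ∞) g M → ∀ z, (z, t) ∈ M → ∀ w : ℂ,
      dirDeriv (fun z => g (z, t)) w z = dirDeriv g (w, 0) (z, t) := by
    intro g hg z hz w
    have h1 : HasFDerivAt (fun z : ℂ => (z, t)) (ContinuousLinearMap.inl ℝ ℂ ℝ) z :=
      hasFDerivAt_prodMk_left z t
    have := (hg.hasFDerivAt_of_isOpen hM hz).comp z h1
    rw [dirDeriv, HasFDerivAt.fderiv (f := fun z => g (z, t)) this]; rfl
  have hfs : ContDiffOn ℝ (⊤ : ℕ∞) (fun z => f (z, t)) ((fun z : ℂ => (z, t)) ⁻¹' M) :=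
    hf.comp (contDiffOn_id.prodMk contDiffOn_const) fun z hz => hz
  have key : ∀ w : ℂ, iteratedFDeriv ℝ 2 (fun z => f (z, t)) z ![w, w] =
      dirDeriv (dirDeriv f (w, 0)) (w, 0) (z, t) := by
    intro w
    rw [iteratedFDeriv_two_apply]
    simp only [Matrix.cons_val_zero, Matrix.cons_val_one]
    rw [← dirDeriv_dirDeriv hΩ hfs hp, ← hder _ (hf.dirDeriv hM _) z hp]
    exact dirDeriv_congr hΩ (fun z hz => hder f hf z hz w) hp w
  rw [lap, key, key, spaceLap]

end spacetime

/-- The logarithm of the conformal factor, as a function on spacetime. -/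
noncomputable def logFactor (u : ℂ → ℝ → ℝ) (p : ℂ × ℝ) : ℝ := Real.log (u p.1 p.2)

/-- The logarithmic time derivative of the conformal factor, i.e. minus twice the Gauss
curvature. -/
noncomputable def logSpeed (u : ℂ → ℝ → ℝ) (p : ℂ × ℝ) : ℝ := dirDeriv (logFactor u) (0, 1) p

namespace ConfRFS

variable {T : ℝ} {M : Set (ℂ × ℝ)} {u : ℂ → ℝ → ℝ} {p : ℂ × ℝ}

theorem contDiffOn_logFactor (h : ConfRFS T M u) : ContDiffOn ℝ (⊤ : ℕ∞) (logFactor u) M :=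
  h.smooth.log fun p hp => (h.pos p hp).ne'

theorem contDiffOn_logSpeed (h : ConfRFS T M u) : ContDiffOn ℝ (⊤ : ℕ∞) (logSpeed u) M :=
  h.contDiffOn_logFactor.dirDeriv h.opn _

theorem exp_logFactor (h : ConfRFS T M u) (hp : p ∈ M) :
    Real.exp (logFactor u p) = u p.1 p.2 := Real.exp_log (h.pos p hp)

theorem dirDeriv_factor (h : ConfRFS T M u) (hp : p ∈ M) (w : ℂ × ℝ) :
    dirDeriv (fun p : ℂ × ℝ => u p.1 p.2) w p = u p.1 p.2 * dirDeriv (logFactor u) w p := by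
  rw [dirDeriv_congr h.opn (g := fun p => Real.exp (logFactor u p))
    (fun p hp => (h.exp_logFactor hp).symm) hp, dirDeriv,
    (h.contDiffOn_logFactor.hasFDerivAt_of_isOpen h.opn hp).exp.fderiv, h.exp_logFactor hp]
  rfl

theorem hasDerivAt_time (h : ConfRFS T M u) {z : ℂ} {t : ℝ} (hp : (z, t) ∈ M) :
    HasDerivAt (u z) (u z t * logSpeed u (z, t)) t := by
  have := h.smooth.hasDerivAt_line h.opn (p := (z, 0)) (0, 1) (s := t) (by simpa using hp)
  simp only [Prod.smul_mk, smul_zero, smul_eq_mul, mul_one, Prod.mk_add_mk, add_zero,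
    zero_add] at this
  rwa [h.dirDeriv_factor hp] at this

theorem spaceLap_logFactor (h : ConfRFS T M u) (hp : p ∈ M) :
    spaceLap (logFactor u) p = u p.1 p.2 * logSpeed u p := by
  have h1 := h.lfde p hp
  rw [(h.hasDerivAt_time (z := p.1) (t := p.2) hp).deriv] at h1
  rw [h1]
  exact (lap_slice_eq_spaceLap h.opn h.contDiffOn_logFactor (z := p.1) (t := p.2) hp).symm

theorem dirDeriv_logSpeed_time (h : ConfRFS T M u) (hp : p ∈ M) :
    dirDeriv (logSpeed u) (0, 1) p = spaceLap (logSpeed u) p / u p.1 p.2 - logSpeed u p ^ 2 := by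
  have hV := h.contDiffOn_logFactor
  have hcomm : ∀ w : ℂ × ℝ, dirDeriv (dirDeriv (dirDeriv (logFactor u) w) w) (0, 1) p =
      dirDeriv (dirDeriv (logSpeed u) w) w p := by
    intro w
    rw [dirDeriv_comm h.opn (hV.dirDeriv h.opn w) hp]
    exact dirDeriv_congr h.opn (fun q hq => dirDeriv_comm h.opn hV hq _ _) hp w
  have h2 : dirDeriv (spaceLap (logFactor u)) (0, 1) p = spaceLap (logSpeed u) p := by
    unfold spaceLap
    rw [dirDeriv_add h.opn ((hV.dirDeriv h.opn _).dirDeriv h.opn _)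
      ((hV.dirDeriv h.opn _).dirDeriv h.opn _) hp, hcomm, hcomm]
  rw [dirDeriv_congr h.opn (fun q hq => h.spaceLap_logFactor hq) hp,
    dirDeriv_mul h.opn h.smooth h.contDiffOn_logSpeed hp, h.dirDeriv_factor hp] at h2
  have hu := h.pos p hp
  change _ + _ * (_ * logSpeed u p) = _ at h2
  rw [← h2]
  field_simp
  ring

end ConfRFS

/-- `f` is differentiable near `0`, with first derivative `a` and second derivative `b` at `0`. -/
def HasJet (f : ℝ → ℝ) (a b : ℝ) : Prop :=
  ∃ f' : ℝ → ℝ, (∀ᶠ l in nhds 0, HasDerivAt f (f' l) l) ∧ f' 0 = a ∧ HasDerivAt f' b 0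

namespace HasJet

variable {f g : ℝ → ℝ} {a b a' b' : ℝ}

theorem hasDerivAt (h : HasJet f a b) : HasDerivAt f a 0 := by
  obtain ⟨f', h1, rfl, -⟩ := h
  exact h1.self_of_nhds

theorem const (c : ℝ) : HasJet (fun _ => c) 0 0 :=
  ⟨fun _ => 0, Eventually.of_forall fun l => hasDerivAt_const l c, rfl, hasDerivAt_const 0 0⟩

theorem quadratic (c α β : ℝ) : HasJet (fun l => c + α * l + β * l ^ 2) α (2 * β) := by
  refine ⟨fun l => α + 2 * β * l, Eventually.of_forall fun l => ?_, by simp, ?_⟩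
  · have h1 := ((hasDerivAt_id l).const_mul α).const_add c
    have h2 := ((hasDerivAt_id l).pow 2).const_mul β
    refine (h1.add h2).congr_deriv ?_
    simp; ring
  · simpa using ((hasDerivAt_id (0:ℝ)).const_mul (2 * β)).const_add α

theorem add (hf : HasJet f a b) (hg : HasJet g a' b') :
    HasJet (fun l => f l + g l) (a + a') (b + b') := by
  obtain ⟨f', h1, rfl, h2⟩ := hf
  obtain ⟨g', k1, rfl, k2⟩ := hg
  refine ⟨fun l => f' l + g' l, ?_, rfl, h2.add k2⟩
  filter_upwards [h1, k1] with l hl kl using hl.add kl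

theorem mul (hf : HasJet f a b) (hg : HasJet g a' b') :
    HasJet (fun l => f l * g l) (a * g 0 + f 0 * a') (b * g 0 + 2 * (a * a') + f 0 * b') := by
  have hf0 := hf.hasDerivAt
  have hg0 := hg.hasDerivAt
  obtain ⟨f', h1, rfl, h2⟩ := hf
  obtain ⟨g', k1, rfl, k2⟩ := hg
  refine ⟨fun l => f' l * g l + f l * g' l, ?_, rfl, ?_⟩
  · filter_upwards [h1, k1] with l hl kl using hl.mul kl
  · refine ((h2.mul hg0).add (hf0.mul k2)).congr_deriv ?_
    ring

theorem const_mul (c : ℝ) (hf : HasJet f a b) : HasJet (fun l => c * f l) (c * a) (c * b) := by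
  simpa using (const c).mul hf

theorem exp (hf : HasJet f a b) : HasJet (fun l => Real.exp (f l)) (Real.exp (f 0) * a)
    (Real.exp (f 0) * (b + a ^ 2)) := by
  have hf0 := hf.hasDerivAt
  obtain ⟨f', h1, rfl, h2⟩ := hf
  refine ⟨fun l => Real.exp (f l) * f' l, ?_, rfl, ?_⟩
  · filter_upwards [h1] with l hl using hl.exp
  · refine (hf0.exp.mul h2).congr_deriv ?_
    ring

theorem sum {f : ℕ → ℝ → ℝ} {a b : ℕ → ℝ} (s : Finset ℕ) (h : ∀ i ∈ s, HasJet (f i) (a i) (b i)) :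
    HasJet (fun l => ∑ i ∈ s, f i l) (∑ i ∈ s, a i) (∑ i ∈ s, b i) := by
  induction s using Finset.induction_on with
  | empty => simpa using const 0
  | insert i s hi ih =>
    simp only [Finset.sum_insert hi]
    exact (h i (Finset.mem_insert_self i s)).add
      (ih fun j hj => h j (Finset.mem_insert_of_mem hj))

theorem congr_of_eventuallyEq (hf : HasJet f a b) (hfg : g =ᶠ[nhds 0] f) : HasJet g a b := by
  obtain ⟨f', h1, rfl, h2⟩ := hf
  refine ⟨f', ?_, rfl, h2⟩
  filter_upwards [h1, hfg.eventuallyEq_nhds] with l hl hl' using hl.congr_of_eventuallyEq hl'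

theorem congr_jet (hf : HasJet f a b) (ha : a = a') (hb : b = b') : HasJet f a' b' := by
  subst ha hb; exact hf

theorem eq_zero_of_isLocalMax (hf : HasJet f a b) (h : IsLocalMax f 0) : a = 0 :=
  h.hasDerivAt_eq_zero hf.hasDerivAt

theorem nonpos_of_isLocalMax (hf : HasJet f a b) (h : IsLocalMax f 0) : b ≤ 0 := by
  by_contra! hb
  have ha := hf.eq_zero_of_isLocalMax h
  obtain ⟨f', h1, h2, h3⟩ := hf
  have hd : deriv f =ᶠ[nhds 0] f' := h1.mono fun l hl => hl.deriv
  have hmin : IsLocalMin f 0 := by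
    refine isLocalMin_of_deriv_deriv_pos ?_ ?_ h1.self_of_nhds.continuousAt
    · rwa [hd.deriv_eq, h3.deriv]
    · rw [hd.self_of_nhds, h2, ha]
  have hconst : f =ᶠ[nhds 0] fun _ => f 0 := by
    filter_upwards [h, hmin] with l hl hl' using le_antisymm hl hl'
  have hzero : f' =ᶠ[nhds 0] fun _ => 0 := by
    filter_upwards [h1, hconst.eventuallyEq_nhds] with l hl hl'
    exact hl.unique ((hasDerivAt_const l (f 0)).congr_of_eventuallyEq hl')
  exact hb.ne' (h3.unique ((hasDerivAt_const (0:ℝ) (0:ℝ)).congr_of_eventuallyEq hzero))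

/-- The second derivative test for a product `(R - e)² f` at an interior maximum. -/
theorem le_of_isLocalMax_cutoff {e : ℝ → ℝ} {f₁ f₂ e₁ e₂ R : ℝ} (hf : HasJet f f₁ f₂)
    (he : HasJet e e₁ e₂) (hR : e 0 < R) (h : IsLocalMax (fun l => (R - e l) ^ 2 * f l) 0) :
    (R - e 0) ^ 2 * f₂ ≤ f 0 * (2 * (R - e 0) * e₂ + 6 * e₁ ^ 2) := by
  have hs : HasJet (fun l => R - e l) (-e₁) (-e₂) := by
    simpa [sub_eq_add_neg] using (const R).add (he.const_mul (-1))
  have hq : HasJet (fun l => (R - e l) ^ 2 * f l) _ _ :=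
    ((hs.mul hs).mul hf).congr_of_eventuallyEq (Eventually.of_forall fun l => by simp [sq])
  have h1 := hq.eq_zero_of_isLocalMax h
  have h2 := hq.nonpos_of_isLocalMax h
  set s := R - e 0
  have hs0 : 0 < s := sub_pos.2 hR
  have h3 : s * f₁ = 2 * e₁ * f 0 := by
    have : s * (s * f₁ - 2 * e₁ * f 0) = 0 := by linear_combination h1
    rcases mul_eq_zero.1 this with h4 | h4
    · exact absurd h4 hs0.ne'
    · linarith
  linear_combination h2 + 4 * e₁ * h3

end HasJet

theorem ContDiffOn.hasJet {E : Type*} [NormedAddCommGroup E] [NormedSpace ℝ E] {f : E → ℝ}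
    {M : Set E} {p : E} (hM : IsOpen M) (hf : ContDiffOn ℝ (⊤ : ℕ∞) f M) (hp : p ∈ M) (w : E) :
    HasJet (fun l : ℝ => f (p + l • w)) (_root_.dirDeriv f w p)
      (_root_.dirDeriv (_root_.dirDeriv f w) w p) := by
  have hev : ∀ᶠ l : ℝ in nhds 0, p + l • w ∈ M := by
    have : ContinuousAt (fun l : ℝ => p + l • w) 0 := by fun_prop
    exact this.eventually (hM.mem_nhds (by simpa using hp))
  refine ⟨fun l => _root_.dirDeriv f w (p + l • w), ?_, by simp, ?_⟩
  · filter_upwards [hev] with l hl using hf.hasDerivAt_line hM w hl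
  · simpa using (hf.dirDeriv hM w).hasDerivAt_line hM w (s := 0) (by simpa using hp)

/-- A left-sided maximum has nonnegative derivative. -/
theorem HasDerivAt.nonneg_of_left_max {f : ℝ → ℝ} {f' t : ℝ} (hf : HasDerivAt f f' t)
    (h : ∀ᶠ s in nhdsWithin t (Iio t), f s ≤ f t) : 0 ≤ f' := by
  have h1 := (hasDerivWithinAt_iff_tendsto_slope' self_notMem_Iio).1
    (hf.hasDerivWithinAt (s := Iio t))
  refine ge_of_tendsto h1 ?_
  filter_upwards [h, self_mem_nhdsWithin] with s hs hst
  rw [slope_def_field]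
  exact div_nonneg_of_nonpos (by linarith) (by linarith [mem_Iio.1 hst])

namespace ConfRFS

variable {T : ℝ} {M : Set (ℂ × ℝ)} {u : ℂ → ℝ → ℝ} {z : ℂ} {t : ℝ}

/-- The complex derivative `∂ log u / ∂z`. -/
noncomputable def _root_.wirtinger (u : ℂ → ℝ → ℝ) (p : ℂ × ℝ) : ℂ :=
  ⟨dirDeriv (logFactor u) (1, 0) p / 2, -(dirDeriv (logFactor u) (Complex.I, 0) p / 2)⟩

theorem _root_.wirtinger_mul_re (u : ℂ → ℝ → ℝ) (p : ℂ × ℝ) (w : ℂ) :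
    2 * (wirtinger u p * w).re = dirDeriv (logFactor u) (w, 0) p := by
  rw [dirDeriv_complex, Complex.mul_re, wirtinger]; ring

theorem hasJet_factor (h : ConfRFS T M u) (hp : (z, t) ∈ M) (w : ℂ) :
    HasJet (fun l : ℝ => u (z + l * w) t) (u z t * dirDeriv (logFactor u) (w, 0) (z, t))
      (u z t * (dirDeriv (dirDeriv (logFactor u) (w, 0)) (w, 0) (z, t) +
        dirDeriv (logFactor u) (w, 0) (z, t) ^ 2)) := by
  have hev : ∀ᶠ l : ℝ in nhds 0, (z, t) + l • ((w, 0) : ℂ × ℝ) ∈ M := by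
    have : ContinuousAt (fun l : ℝ => (z, t) + l • ((w, 0) : ℂ × ℝ)) 0 := by fun_prop
    exact this.eventually (h.opn.mem_nhds (by simpa using hp))
  have h1 := (h.contDiffOn_logFactor.hasJet h.opn hp (w, 0)).exp
  simp only [zero_smul, add_zero] at h1
  rw [h.exp_logFactor hp] at h1
  refine h1.congr_of_eventuallyEq ?_
  filter_upwards [hev] with l hl
  rw [h.exp_logFactor hl]
  simp

theorem hasJet_link (h : ConfRFS T M u) (hp : (z, t) ∈ M) (D w : ℂ) :
    HasJet (fun l : ℝ => u (z + l * w) t * ‖D - l * (wirtinger u (z, t) * w * D)‖ ^ 2) 0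
      (‖D‖ ^ 2 * u z t * (dirDeriv (dirDeriv (logFactor u) (w, 0)) (w, 0) (z, t) -
        dirDeriv (logFactor u) (w, 0) (z, t) ^ 2 + 2 * ‖wirtinger u (z, t) * w‖ ^ 2)) := by
  have h1 := (h.hasJet_factor hp w).mul (HasJet.quadratic (‖D‖ ^ 2)
    (-(‖D‖ ^ 2 * (2 * (wirtinger u (z, t) * w).re))) (‖D‖ ^ 2 * ‖wirtinger u (z, t) * w‖ ^ 2))
  rw [wirtinger_mul_re] at h1
  refine (h1.congr_of_eventuallyEq (Eventually.of_forall fun l => ?_)).congr_jet ?_ ?_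
  · simp only
    congr 1
    rw [← wirtinger_mul_re]
    have : D - l * (wirtinger u (z, t) * w * D) = D * (1 - l * (wirtinger u (z, t) * w)) := by ring
    rw [this, norm_mul, mul_pow, Complex.sq_norm (1 - _), Complex.sq_norm (wirtinger _ _ * w),
      Complex.normSq_apply, Complex.normSq_apply]
    simp [-Complex.mul_re, -Complex.mul_im, Complex.re_ofReal_mul, Complex.im_ofReal_mul]
    ring
  · simp; ring
  · simp; ring

/-- The second variations of a link in two orthogonal directions add up to a curvature term. -/
theorem link_second_variation_add (h : ConfRFS T M u) (hp : (z, t) ∈ M) (D w : ℂ) :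
    ‖D‖ ^ 2 * u z t * (dirDeriv (dirDeriv (logFactor u) (w, 0)) (w, 0) (z, t) -
        dirDeriv (logFactor u) (w, 0) (z, t) ^ 2 + 2 * ‖wirtinger u (z, t) * w‖ ^ 2) +
    ‖D‖ ^ 2 * u z t * (dirDeriv (dirDeriv (logFactor u) (Complex.I * w, 0)) (Complex.I * w, 0) (z, t)
        - dirDeriv (logFactor u) (Complex.I * w, 0) (z, t) ^ 2 +
        2 * ‖wirtinger u (z, t) * (Complex.I * w)‖ ^ 2) =
    ‖D‖ ^ 2 * u z t * (‖w‖ ^ 2 * u z t * logSpeed u (z, t)) := by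
  have h1 := dirDeriv_dirDeriv_rotate h.opn h.contDiffOn_logFactor hp w
  rw [h.spaceLap_logFactor hp] at h1
  have h2 : wirtinger u (z, t) * (Complex.I * w) = Complex.I * (wirtinger u (z, t) * w) := by ring
  rw [← mul_add, ← wirtinger_mul_re u _ w, ← wirtinger_mul_re u _ (Complex.I * w), h2]
  congr 1
  have h3 : ‖Complex.I * (wirtinger u (z, t) * w)‖ = ‖wirtinger u (z, t) * w‖ := by simp
  have h4 : (Complex.I * (wirtinger u (z, t) * w)).re = -(wirtinger u (z, t) * w).im := by simp
  rw [h3, h4, Complex.sq_norm (wirtinger _ _ * w), Complex.normSq_apply]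
  linear_combination h1

end ConfRFS

/-- The energy of the polygonal chain `y 0, …, y n`, whose links have a quadratic cost dominating
their length, and whose initial point is penalized by its distance to `x₀`. -/
noncomputable def chainEnergy (u : ℂ → ℝ → ℝ) (x₀ : ℂ) (B δ : ℝ) (n : ℕ) (y : ℕ → ℂ) (t : ℝ) : ℝ :=
  B * ‖y 0 - x₀‖ ^ 2 +
    ∑ i ∈ Finset.range n, (u (y (i + 1)) t * ‖y (i + 1) - y i‖ ^ 2 / δ + δ) / 2

/-- The velocities of the chain variation along which the links are stationary. -/
noncomputable def chainVelocity (u : ℂ → ℝ → ℝ) (n : ℕ) (y : ℕ → ℂ) (t : ℝ) (i : ℕ) : ℂ :=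
  ∏ j ∈ Finset.Ico i n, (1 + wirtinger u (y (j + 1), t) * (y (j + 1) - y j))

/-- The variation of the chain `y` in the direction `ζ`. -/
noncomputable def chainVariation (u : ℂ → ℝ → ℝ) (n : ℕ) (y : ℕ → ℂ) (t : ℝ) (ζ : ℂ) (i : ℕ) : ℂ :=
  if i ≤ n then y i + ζ * chainVelocity u n y t i else y i

theorem chainVelocity_self (u : ℂ → ℝ → ℝ) (n : ℕ) (y : ℕ → ℂ) (t : ℝ) :
    chainVelocity u n y t n = 1 := by simp [chainVelocity]

theorem chainVelocity_succ (u : ℂ → ℝ → ℝ) {n : ℕ} (y : ℕ → ℂ) (t : ℝ) {i : ℕ} (hi : i < n) :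
    chainVelocity u n y t i =
      (1 + wirtinger u (y (i + 1), t) * (y (i + 1) - y i)) * chainVelocity u n y t (i + 1) :=
  Finset.prod_eq_prod_Ico_succ_bot hi _

theorem chainVariation_of_le (u : ℂ → ℝ → ℝ) {n : ℕ} (y : ℕ → ℂ) (t : ℝ) (ζ : ℂ) {i : ℕ}
    (hi : i ≤ n) : chainVariation u n y t ζ i = y i + ζ * chainVelocity u n y t i := if_pos hi

theorem chainVariation_self (u : ℂ → ℝ → ℝ) (n : ℕ) (y : ℕ → ℂ) (t : ℝ) (ζ : ℂ) :
    chainVariation u n y t ζ n = y n + ζ := by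
  rw [chainVariation_of_le u y t ζ le_rfl, chainVelocity_self, mul_one]

theorem chainVariation_zero (u : ℂ → ℝ → ℝ) (n : ℕ) (y : ℕ → ℂ) (t : ℝ) :
    chainVariation u n y t 0 = y := by
  ext i; simp [chainVariation]

theorem continuous_chainVariation (u : ℂ → ℝ → ℝ) (n : ℕ) (y : ℕ → ℂ) (t : ℝ) (i : ℕ) :
    Continuous fun ζ => chainVariation u n y t ζ i := by
  unfold chainVariation
  split_ifs <;> fun_prop

namespace ConfRFS

variable {T : ℝ} {M : Set (ℂ × ℝ)} {u : ℂ → ℝ → ℝ} {x₀ : ℂ} {B δ t : ℝ} {n : ℕ} {y : ℕ → ℂ}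

theorem hasJet_chainEnergy (h : ConfRFS T M u) (hy : ∀ i ≤ n, (y i, t) ∈ M) (d : ℂ) :
    HasJet (fun l : ℝ => chainEnergy u x₀ B δ n (chainVariation u n y t (l * d)) t)
      (2 * B * ((starRingEnd ℂ) (y 0 - x₀) * (d * chainVelocity u n y t 0)).re)
      (2 * B * ‖d * chainVelocity u n y t 0‖ ^ 2 + ∑ i ∈ Finset.range n,
        1 / (2 * δ) * (‖y (i + 1) - y i‖ ^ 2 * u (y (i + 1)) t *
          (dirDeriv (dirDeriv (logFactor u) (d * chainVelocity u n y t (i + 1), 0))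
              (d * chainVelocity u n y t (i + 1), 0) (y (i + 1), t) -
            dirDeriv (logFactor u) (d * chainVelocity u n y t (i + 1), 0) (y (i + 1), t) ^ 2 +
          2 * ‖wirtinger u (y (i + 1), t) * (d * chainVelocity u n y t (i + 1))‖ ^ 2))) := by
  set P := chainVelocity u n y t
  have h1 := HasJet.quadratic (B * ‖y 0 - x₀‖ ^ 2)
    (2 * B * ((starRingEnd ℂ) (y 0 - x₀) * (d * P 0)).re) (B * ‖d * P 0‖ ^ 2)
  have h2 := HasJet.sum (Finset.range n) fun i hi =>
    (HasJet.const (δ / 2)).add ((h.hasJet_link (hy (i + 1) (Finset.mem_range.1 hi))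
      (y (i + 1) - y i) (d * P (i + 1))).const_mul (1 / (2 * δ)))
  refine ((h1.add h2).congr_of_eventuallyEq (Eventually.of_forall fun l => ?_)).congr_jet
    (by simp) (by simp only [zero_add]; ring)
  simp only [chainEnergy]
  congr 1
  · rw [chainVariation_of_le u y t _ (Nat.zero_le n)]
    have : y 0 + l * d * P 0 - x₀ = (y 0 - x₀) + l * (d * P 0) := by ring
    rw [this, Complex.sq_norm, Complex.sq_norm, Complex.sq_norm, Complex.normSq_apply,
      Complex.normSq_apply, Complex.normSq_apply]
    simp only [Complex.add_re, Complex.add_im, Complex.re_ofReal_mul, Complex.im_ofReal_mul,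
      Complex.mul_re (starRingEnd ℂ _), Complex.conj_re, Complex.conj_im]
    ring
  · refine Finset.sum_congr rfl fun i hi => ?_
    have hin := Finset.mem_range.1 hi
    rw [chainVariation_of_le u y t _ hin, chainVariation_of_le u y t _ hin.le]
    have : y (i + 1) + l * d * P (i + 1) - (y i + l * d * P i) =
        y (i + 1) - y i - l * (wirtinger u (y (i + 1), t) * (d * P (i + 1)) *
          (y (i + 1) - y i)) := by
      rw [show P i = _ from chainVelocity_succ u y t hin]; ring
    rw [this, mul_assoc (l : ℂ) d]
    ring

theorem hasDerivAt_chainEnergy (h : ConfRFS T M u) (hy : ∀ i ≤ n, (y i, t) ∈ M) :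
    HasDerivAt (chainEnergy u x₀ B δ n y) (∑ i ∈ Finset.range n,
      1 / (2 * δ) * (‖y (i + 1) - y i‖ ^ 2 * u (y (i + 1)) t * logSpeed u (y (i + 1), t))) t := by
  have h2 := HasDerivAt.fun_sum (u := Finset.range n) fun i hi =>
    ((((h.hasDerivAt_time (hy (i + 1) (Finset.mem_range.1 hi))).mul_const
      (‖y (i + 1) - y i‖ ^ 2)).div_const δ).add_const δ).div_const 2
  refine (h2.const_add (B * ‖y 0 - x₀‖ ^ 2)).congr_deriv (Finset.sum_congr rfl fun i _ => ?_)
  ring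

/-- The differential inequality at a maximum of the localized curvature. -/
theorem localized_max_le (h : ConfRFS T M u) {a R : ℝ} (hy : ∀ i ≤ n, (y i, t) ∈ M) (hat : a < t)
    (hR : chainEnergy u x₀ B δ n y t < R) (hF : 0 < logSpeed u (y n, t))
    (hspace : ∀ d : ℂ, IsLocalMax (fun l : ℝ =>
      (R - chainEnergy u x₀ B δ n (chainVariation u n y t (l * d)) t) ^ 2 *
        logSpeed u (y n + l * d, t)) 0)
    (htime : ∀ᶠ s in nhdsWithin t (Iio t),
      (s - a) * ((R - chainEnergy u x₀ B δ n y s) ^ 2 * logSpeed u (y n, s)) ≤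
        (t - a) * ((R - chainEnergy u x₀ B δ n y t) ^ 2 * logSpeed u (y n, t))) :
    (t - a) * ((R - chainEnergy u x₀ B δ n y t) ^ 2 * logSpeed u (y n, t)) ≤
      (R - chainEnergy u x₀ B δ n y t) ^ 2 + (t - a) *
        (2 * (R - chainEnergy u x₀ B δ n y t) *
          (4 * B * ‖chainVelocity u n y t 0‖ ^ 2 / u (y n) t + ∑ i ∈ Finset.range n,
            1 / (2 * δ) * (‖y (i + 1) - y i‖ ^ 2 * u (y (i + 1)) t * logSpeed u (y (i + 1), t)) *
              (‖chainVelocity u n y t (i + 1)‖ ^ 2 * u (y (i + 1)) t / u (y n) t - 1)) +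
        24 * B ^ 2 * ‖y 0 - x₀‖ ^ 2 * ‖chainVelocity u n y t 0‖ ^ 2 / u (y n) t) := by
  have hU := h.pos _ (hy n le_rfl)
  have hFsm := h.contDiffOn_logSpeed
  have hFjet : ∀ d : ℂ, HasJet (fun l : ℝ => logSpeed u (y n + l * d, t))
      (dirDeriv (logSpeed u) (d, 0) (y n, t))
      (dirDeriv (dirDeriv (logSpeed u) (d, 0)) (d, 0) (y n, t)) := fun d =>
    (hFsm.hasJet h.opn (hy n le_rfl) (d, 0)).congr_of_eventuallyEq
      (Eventually.of_forall fun l => by simp)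
  have hFt : HasDerivAt (fun s => logSpeed u (y n, s))
      (dirDeriv (logSpeed u) (0, 1) (y n, t)) t := by
    simpa using hFsm.hasDerivAt_line h.opn (p := (y n, 0)) (0, 1) (s := t)
      (by simpa using hy n le_rfl)
  have hst := HasDerivAt.nonneg_of_left_max (((hasDerivAt_id' t).sub_const a).fun_mul
    ((((h.hasDerivAt_chainEnergy (x₀ := x₀) (B := B) (δ := δ) hy).const_sub R).fun_pow 2).fun_mul
      hFt)) htime
  have hsp := fun d : ℂ => (hFjet d).le_of_isLocalMax_cutoff
    (h.hasJet_chainEnergy (x₀ := x₀) (B := B) (δ := δ) hy d)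
    (by simpa [chainVariation_zero] using hR) (hspace d)
  have hs1 := hsp 1
  have hs2 := hsp Complex.I
  simp only [Complex.ofReal_zero, zero_mul, add_zero, chainVariation_zero, one_mul] at hs1 hs2
  rw [h.dirDeriv_logSpeed_time (hy n le_rfl)] at hst
  have hs3 := add_le_add hs1 hs2
  have hlap : dirDeriv (dirDeriv (logSpeed u) (1, 0)) (1, 0) (y n, t) +
      dirDeriv (dirDeriv (logSpeed u) (Complex.I, 0)) (Complex.I, 0) (y n, t) =
      spaceLap (logSpeed u) (y n, t) := rfl
  set P := chainVelocity u n y t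
  have hsum : ∀ i ∈ Finset.range n, _ := fun i hi => congrArg (fun x => 1 / (2 * δ) * x)
    (h.link_second_variation_add (hy (i + 1) (Finset.mem_range.1 hi)) (y (i + 1) - y i) (P (i + 1)))
  have hsum' := Finset.sum_congr rfl hsum
  simp only [mul_add (1 / (2 * δ)), Finset.sum_add_distrib] at hsum'
  have hgrad : ((starRingEnd ℂ) (y 0 - x₀) * P 0).re ^ 2 +
      ((starRingEnd ℂ) (y 0 - x₀) * (Complex.I * P 0)).re ^ 2 =
      ‖y 0 - x₀‖ ^ 2 * ‖P 0‖ ^ 2 := by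
    rw [Complex.sq_norm, Complex.sq_norm, Complex.normSq_apply, Complex.normSq_apply]
    simp; ring
  have hIP : ‖Complex.I * P 0‖ = ‖P 0‖ := by simp
  have hrhs : ∑ i ∈ Finset.range n,
      1 / (2 * δ) * (‖y (i + 1) - y i‖ ^ 2 * u (y (i + 1)) t * logSpeed u (y (i + 1), t)) *
        (‖P (i + 1)‖ ^ 2 * u (y (i + 1)) t / u (y n) t - 1) =
      (∑ i ∈ Finset.range n, 1 / (2 * δ) * (‖y (i + 1) - y i‖ ^ 2 * u (y (i + 1)) t *
        (‖P (i + 1)‖ ^ 2 * u (y (i + 1)) t * logSpeed u (y (i + 1), t)))) / u (y n) t -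
      ∑ i ∈ Finset.range n,
        1 / (2 * δ) * (‖y (i + 1) - y i‖ ^ 2 * u (y (i + 1)) t * logSpeed u (y (i + 1), t)) := by
    rw [Finset.sum_div, ← Finset.sum_sub_distrib]
    exact Finset.sum_congr rfl fun i _ => by ring
  rw [hrhs, ← hsum']
  rw [hIP] at hs3
  simp only at hU hst
  set e := chainEnergy u x₀ B δ n y t
  set F := logSpeed u (y n, t)
  set U := u (y n) t
  set S₁ := ∑ i ∈ Finset.range n, 1 / (2 * δ) * (‖y (i + 1) - y i‖ ^ 2 * u (y (i + 1)) t *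
    (dirDeriv (dirDeriv (logFactor u) (P (i + 1), 0)) (P (i + 1), 0) (y (i + 1), t) -
      dirDeriv (logFactor u) (P (i + 1), 0) (y (i + 1), t) ^ 2 +
      2 * ‖wirtinger u (y (i + 1), t) * P (i + 1)‖ ^ 2))
  set S₂ := ∑ i ∈ Finset.range n, 1 / (2 * δ) * (‖y (i + 1) - y i‖ ^ 2 * u (y (i + 1)) t *
    (dirDeriv (dirDeriv (logFactor u) (Complex.I * P (i + 1), 0)) (Complex.I * P (i + 1), 0)
        (y (i + 1), t) -
      dirDeriv (logFactor u) (Complex.I * P (i + 1), 0) (y (i + 1), t) ^ 2 +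
      2 * ‖wirtinger u (y (i + 1), t) * (Complex.I * P (i + 1))‖ ^ 2))
  set E := ∑ i ∈ Finset.range n,
    1 / (2 * δ) * (‖y (i + 1) - y i‖ ^ 2 * u (y (i + 1)) t * logSpeed u (y (i + 1), t))
  set L := spaceLap (logSpeed u) (y n, t)
  have h4 : (R - e) ^ 2 * (L / U) ≤ F * ((2 * (R - e) * (4 * B * ‖P 0‖ ^ 2 + (S₁ + S₂)) +
      24 * B ^ 2 * ‖y 0 - x₀‖ ^ 2 * ‖P 0‖ ^ 2) / U) := by
    rw [mul_div_assoc', mul_div_assoc', div_le_div_iff_of_pos_right hU, ← hlap]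
    refine le_trans (le_of_eq (by ring)) (hs3.trans (le_of_eq ?_))
    linear_combination 24 * F * B ^ 2 * hgrad
  have hσ : 0 < t - a := sub_pos.2 hat
  refine le_of_mul_le_mul_left ?_ hF
  have h5 := mul_le_mul_of_nonneg_left h4 hσ.le
  have h6 : (4 * B * ‖P 0‖ ^ 2 / U + ((S₁ + S₂) / U - E)) =
    (4 * B * ‖P 0‖ ^ 2 + (S₁ + S₂)) / U - E := by ring
  rw [h6]
  have h7 : 24 * B ^ 2 * ‖y 0 - x₀‖ ^ 2 * ‖P 0‖ ^ 2 / U + 2 * (R - e) *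
      ((4 * B * ‖P 0‖ ^ 2 + (S₁ + S₂)) / U) = ((2 * (R - e) * (4 * B * ‖P 0‖ ^ 2 + (S₁ + S₂)) +
      24 * B ^ 2 * ‖y 0 - x₀‖ ^ 2 * ‖P 0‖ ^ 2) / U) := by ring
  rw [← h7] at h5
  push_cast at hst
  linear_combination hst + h5

end ConfRFS

theorem ContDiffOn.exists_bound_fderiv {E G : Type*} [NormedAddCommGroup E] [NormedSpace ℝ E]
    [NormedAddCommGroup G] [NormedSpace ℝ G] {f : E → G} {M K : Set E} (hM : IsOpen M)
    (hf : ContDiffOn ℝ (⊤ : ℕ∞) f M) (hK : IsCompact K) (hKM : K ⊆ M) :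
    ∃ C, ∀ p ∈ K, ‖fderiv ℝ f p‖ ≤ C :=
  hK.exists_bound_of_continuousOn
    ((hf.fderiv_of_isOpen (m := (⊤ : ℕ∞)) hM (by simp)).continuousOn.mono hKM)

/-- Uniform first and second order Taylor estimates for `log u` in space, near the points of `K`. -/
structure TaylorBound (M : Set (ℂ × ℝ)) (u : ℂ → ℝ → ℝ) (K : Set (ℂ × ℝ)) (ε C : ℝ) : Prop where
  nonneg : 0 ≤ C
  norm_wirtinger : ∀ p ∈ K, ‖wirtinger u p‖ ≤ C
  mem : ∀ p ∈ K, ∀ z : ℂ, ‖z - p.1‖ ≤ ε → (z, p.2) ∈ M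
  first_order : ∀ p ∈ K, ∀ z : ℂ, ‖z - p.1‖ ≤ ε →
    |logFactor u (z, p.2) - logFactor u p| ≤ C * ‖z - p.1‖
  second_order : ∀ p ∈ K, ∀ z : ℂ, ‖z - p.1‖ ≤ ε →
    |logFactor u (z, p.2) - logFactor u p - dirDeriv (logFactor u) (z - p.1, 0) p| ≤
      C * ‖z - p.1‖ ^ 2

namespace ConfRFS

variable {T : ℝ} {M : Set (ℂ × ℝ)} {u : ℂ → ℝ → ℝ} {K : Set (ℂ × ℝ)} {ε C t : ℝ} {n : ℕ}
  {y : ℕ → ℂ}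

theorem exists_taylorBound (h : ConfRFS T M u) {K' : Set (ℂ × ℝ)} (hK' : IsCompact K')
    (hK'M : K' ⊆ M) (hε : 0 < ε) (hKK' : ∀ p ∈ K, ∀ z : ℂ, ‖z - p.1‖ ≤ ε → (z, p.2) ∈ K') :
    ∃ C, TaylorBound M u K ε C := by
  set V := logFactor u
  have hV := h.contDiffOn_logFactor
  have hV1 : ContDiffOn ℝ (⊤ : ℕ∞) (fderiv ℝ V) M := hV.fderiv_of_isOpen h.opn (by simp)
  obtain ⟨C₁, hC₁⟩ := hV.exists_bound_fderiv h.opn hK' hK'M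
  obtain ⟨C₂, hC₂⟩ := hV1.exists_bound_fderiv h.opn hK' hK'M
  set C := max (max C₁ C₂) 0
  have hC0 : 0 ≤ C := le_max_right _ _
  have hC₁' : ∀ p ∈ K', ‖fderiv ℝ V p‖ ≤ C := fun p hp =>
    (hC₁ p hp).trans ((le_max_left _ _).trans (le_max_left _ _))
  have hC₂' : ∀ p ∈ K', ‖fderiv ℝ (fderiv ℝ V) p‖ ≤ C := fun p hp =>
    (hC₂ p hp).trans ((le_max_right _ _).trans (le_max_left _ _))
  have hself : ∀ p ∈ K, p ∈ K' := fun p hp => hKK' p hp p.1 (by simpa using hε.le)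
  have hd1 : ∀ p ∈ M, HasFDerivAt V (fderiv ℝ V p) p := fun p hp =>
    hV.hasFDerivAt_of_isOpen h.opn hp
  have hd2 : ∀ p ∈ M, HasFDerivAt (fderiv ℝ V) (fderiv ℝ (fderiv ℝ V) p) p := fun p hp =>
    ((hV1.contDiffAt (h.opn.mem_nhds hp)).differentiableAt (by simp)).hasFDerivAt
  have hconv : ∀ (p : ℂ × ℝ) (r : ℝ), Convex ℝ (closedBall p.1 r ×ˢ {p.2}) := fun p r =>
    (convex_closedBall _ _).prod (convex_singleton _)
  have hsub : ∀ p ∈ K, ∀ r ≤ ε, ∀ q ∈ closedBall p.1 r ×ˢ {p.2}, q ∈ K' := by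
    rintro p hp r hr ⟨z, s⟩ ⟨hz, hs⟩
    obtain rfl : s = p.2 := hs
    exact hKK' p hp z ((mem_closedBall_iff_norm.1 hz).trans hr)
  have hnorm : ∀ (p : ℂ × ℝ) (z : ℂ), ‖(z, p.2) - p‖ = ‖z - p.1‖ := fun p z => by
    simp [Prod.norm_def]
  refine ⟨C, hC0, fun p hp => ?_, fun p hp z hz => hK'M (hKK' p hp z hz),
    fun p hp z hz => ?_, fun p hp z hz => ?_⟩
  · have hbd : ∀ w : ℂ, ‖w‖ = 1 → |dirDeriv V (w, 0) p| ≤ C := by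
      intro w hw
      have := (fderiv ℝ V p).le_opNorm (w, 0)
      simp only [Prod.norm_def, hw, norm_zero, zero_le_one, sup_of_le_left, mul_one] at this
      exact this.trans (hC₁' p (hself p hp))
    have h1 := hbd 1 (by simp)
    have h2 := hbd Complex.I (by simp)
    refine (Complex.norm_le_abs_re_add_abs_im _).trans ?_
    simp only [wirtinger, abs_neg, abs_div, abs_two]
    linarith
  · have := (hconv p ‖z - p.1‖).norm_image_sub_le_of_norm_hasFDerivWithin_le (f := V)
      (fun q hq => (hd1 q (hK'M (hsub p hp _ hz q hq))).hasFDerivWithinAt)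
      (fun q hq => hC₁' q (hsub p hp _ hz q hq))
      (show p ∈ _ from ⟨mem_closedBall_self (norm_nonneg _), rfl⟩)
      (show (z, p.2) ∈ _ from ⟨mem_closedBall_iff_norm.2 le_rfl, rfl⟩)
    rwa [hnorm] at this
  · have hp0 : p ∈ closedBall p.1 ‖z - p.1‖ ×ˢ {p.2} :=
      ⟨mem_closedBall_self (norm_nonneg _), rfl⟩
    have h1 : ∀ q ∈ closedBall p.1 ‖z - p.1‖ ×ˢ {p.2},
        ‖fderiv ℝ V q - fderiv ℝ V p‖ ≤ C * ‖z - p.1‖ := by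
      rintro ⟨w, s⟩ hq
      have hw := mem_closedBall_iff_norm.1 hq.1
      have h2 := (hconv p ‖z - p.1‖).norm_image_sub_le_of_norm_hasFDerivWithin_le (f := fderiv ℝ V)
        (fun q hq => (hd2 q (hK'M (hsub p hp _ hz q hq))).hasFDerivWithinAt)
        (fun q hq => hC₂' q (hsub p hp _ hz q hq)) hp0 hq
      obtain rfl : s = p.2 := hq.2
      rw [hnorm] at h2
      exact h2.trans (mul_le_mul_of_nonneg_left hw hC0)
    have := (hconv p ‖z - p.1‖).norm_image_sub_le_of_norm_hasFDerivWithin_le' (f := V)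
      (φ := fderiv ℝ V p)
      (fun q hq => (hd1 q (hK'M (hsub p hp _ hz q hq))).hasFDerivWithinAt) h1 hp0
      (show (z, p.2) ∈ _ from ⟨mem_closedBall_iff_norm.2 le_rfl, rfl⟩)
    rw [hnorm] at this
    have h3 : (z, p.2) - p = (z - p.1, 0) := by ext <;> simp
    rw [h3] at this
    refine this.trans (le_of_eq ?_)
    ring

theorem link_ratio (h : ConfRFS T M u) (hC : TaylorBound M u K ε C) {z w : ℂ}
    (hz : (z, t) ∈ K) (hw : ‖w - z‖ ≤ ε) (hCw : C * ‖w - z‖ ≤ 1 / 2) :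
    1 + wirtinger u (z, t) * (z - w) ≠ 0 ∧
    |Real.log (‖1 + wirtinger u (z, t) * (z - w)‖ ^ 2 * u w t) - Real.log (u z t)| ≤
      (C + 2 * C ^ 2) * ‖w - z‖ ^ 2 := by
  set κ := wirtinger u (z, t)
  have hκ : ‖κ * (z - w)‖ ≤ C * ‖w - z‖ := by
    rw [norm_mul, norm_sub_rev z w]
    exact mul_le_mul_of_nonneg_right (hC.norm_wirtinger _ hz) (norm_nonneg _)
  have hne : 1 + κ * (z - w) ≠ 0 := by
    intro h0
    have : κ * (z - w) = -1 := by linear_combination h0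
    rw [this] at hκ
    simp at hκ; linarith
  refine ⟨hne, ?_⟩
  have h1 := hC.second_order _ hz w hw
  have h2 := Complex.norm_log_one_add_sub_self_le (z := κ * (z - w)) (by linarith)
  have h3 := (Complex.abs_re_le_norm _).trans h2
  rw [Complex.sub_re, Complex.log_re] at h3
  have h4 : dirDeriv (logFactor u) (w - z, 0) (z, t) = -(2 * (κ * (z - w)).re) := by
    rw [← wirtinger_mul_re, ← neg_sub z w, mul_neg, Complex.neg_re]; ring
  have h5 : ‖κ * (z - w)‖ ^ 2 * (1 - ‖κ * (z - w)‖)⁻¹ / 2 ≤ C ^ 2 * ‖w - z‖ ^ 2 := by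
    have h6 : (1 - ‖κ * (z - w)‖)⁻¹ ≤ 2 := by
      rw [inv_le_comm₀ (by linarith) (by norm_num)]; linarith
    have h7 : ‖κ * (z - w)‖ ^ 2 ≤ (C * ‖w - z‖) ^ 2 := by gcongr
    nlinarith [sq_nonneg ‖κ * (z - w)‖]
  have hu := h.pos _ (hC.mem _ hz w hw)
  rw [Real.log_mul (by simpa using hne) hu.ne', Real.log_pow]
  simp only [logFactor] at h1
  rw [show dirDeriv _ _ _ = _ from h4] at h1
  have h8 := h3.trans h5
  rw [abs_le] at h1 h8 ⊢
  push_cast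
  constructor <;> nlinarith [h1.1, h1.2, h8.1, h8.2]

theorem chain_ratio (h : ConfRFS T M u) (hC : TaylorBound M u K ε C) (hy : ∀ i ≤ n, (y i, t) ∈ K)
    (h0 : 0 ≤ ε) (hε : ∀ i < n, ‖y (i + 1) - y i‖ ≤ ε)
    (hCy : ∀ i < n, C * ‖y (i + 1) - y i‖ ≤ 1 / 2) {i : ℕ} (hi : i ≤ n) : |‖chainVelocity u n y t i‖ ^ 2 * u (y i) t / u (y n) t - 1| ≤
      Real.exp ((C + 2 * C ^ 2) * ∑ j ∈ Finset.range n, ‖y (j + 1) - y j‖ ^ 2) - 1 := by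
  have hyM : ∀ i ≤ n, 0 < u (y i) t := fun i hi =>
    h.pos _ (hC.mem _ (hy i hi) (y i) (by simpa using h0))
  have key : ∀ k i : ℕ, i + k = n → chainVelocity u n y t i ≠ 0 ∧
      |Real.log (‖chainVelocity u n y t i‖ ^ 2 * u (y i) t) - Real.log (u (y n) t)| ≤
        (C + 2 * C ^ 2) * ∑ j ∈ Finset.Ico i n, ‖y (j + 1) - y j‖ ^ 2 := by
    intro k
    induction k with
    | zero => rintro i rfl; simp [chainVelocity_self]
    | succ k ih =>
      intro i hin
      obtain ⟨h1, h2⟩ := ih (i + 1) (by omega)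
      have hlt : i < n := by omega
      obtain ⟨h3, h4⟩ := h.link_ratio hC (z := y (i + 1)) (w := y i) (hy _ hlt)
        (by rw [norm_sub_rev]; exact hε i hlt) (by rw [norm_sub_rev]; exact hCy i hlt)
      rw [chainVelocity_succ u y t hlt]
      refine ⟨mul_ne_zero h3 h1, ?_⟩
      have hp1 := hyM i hlt.le
      have hp2 := hyM (i + 1) hlt
      have hn1 := norm_pos_iff.2 h1
      have hn3 := norm_pos_iff.2 h3
      rw [norm_sub_rev] at h4
      rw [Finset.sum_eq_sum_Ico_succ_bot hlt, mul_add, norm_mul, mul_pow]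
      rw [Real.log_mul (by positivity) hp2.ne'] at h2
      rw [Real.log_mul (by positivity) hp1.ne'] at h4
      rw [Real.log_mul (by positivity) hp1.ne', Real.log_mul (by positivity) (by positivity)]
      refine le_trans (le_of_eq ?_) ((abs_add_le _ _).trans (add_le_add h4 h2))
      congr 1; ring
  obtain ⟨h1, h2⟩ := key (n - i) i (by omega)
  have hn1 := norm_pos_iff.2 h1
  have hpi := hyM i hi
  have hpn := hyM n le_rfl
  set S := (C + 2 * C ^ 2) * ∑ j ∈ Finset.range n, ‖y (j + 1) - y j‖ ^ 2
  have hS : (C + 2 * C ^ 2) * ∑ j ∈ Finset.Ico i n, ‖y (j + 1) - y j‖ ^ 2 ≤ S := by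
    refine mul_le_mul_of_nonneg_left ?_ (by have := hC.nonneg; positivity)
    refine Finset.sum_le_sum_of_subset_of_nonneg (fun j hj => ?_) fun _ _ _ => by positivity
    simp only [Finset.mem_Ico, Finset.mem_range] at hj ⊢; omega
  have h3 := h2.trans hS
  rw [← Real.log_div (by positivity) hpn.ne', abs_le] at h3
  set q := ‖chainVelocity u n y t i‖ ^ 2 * u (y i) t / u (y n) t
  have hq : 0 < q := by positivity
  have h4 := (Real.log_le_iff_le_exp hq).1 h3.2
  have h5 := (Real.le_log_iff_exp_le hq).1 h3.1
  have h6 : 2 ≤ Real.exp S + Real.exp (-S) := by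
    have := Real.one_le_cosh S
    rw [Real.cosh_eq] at this; linarith
  rw [abs_le]
  constructor <;> linarith

theorem chain_reach (h : ConfRFS T M u) (hC : TaylorBound M u K ε C)
    (hy : ∀ i ≤ n, (y i, t) ∈ K) {l : ℝ} (hl : l ≤ ε) (hyl : ∀ i < n, ‖y (i + 1) - y i‖ ≤ l)
    {D : Set ℂ} (hD : y 0 ∈ D) : ∀ i ≤ n, Reach (fun z => u z t) (timeSlice M t) D
      (Real.exp (C * l) * ∑ j ∈ Finset.range i, √(u (y (j + 1)) t) * ‖y (j + 1) - y j‖) (y i) := by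
  intro i
  induction i with
  | zero => intro _; exact .start hD (by simp)
  | succ i ih =>
    intro hi
    refine .step (m := Real.exp (C * l) * √(u (y (i + 1)) t)) (ih (by omega)) (fun z hz => ?_) ?_
    · have hz1 : ‖z - y (i + 1)‖ ≤ ‖y (i + 1) - y i‖ := by
        rw [← mem_closedBall_iff_norm]
        refine (convex_closedBall _ _).segment_subset ?_
          (mem_closedBall_self (norm_nonneg _)) hz
        rw [mem_closedBall_iff_norm, norm_sub_rev]
      have hz2 := hz1.trans (hyl i hi)
      have hzM := hC.mem _ (hy _ hi) z (hz2.trans hl)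
      refine ⟨hzM, ?_⟩
      have h1 := (abs_le.1 (hC.first_order _ (hy _ hi) z (hz2.trans hl))).2
      have h2 := mul_le_mul_of_nonneg_left hz2 hC.nonneg
      have hyM := hC.mem _ (hy _ hi) (y (i + 1))
        (by simpa using (norm_nonneg _).trans (hz2.trans hl))
      have h0 : 0 ≤ C * l := mul_nonneg hC.nonneg ((norm_nonneg _).trans hz2)
      have h3 : u z t ≤ Real.exp (C * l) ^ 2 * u (y (i + 1)) t := by
        rw [← h.exp_logFactor hzM, ← h.exp_logFactor hyM, sq, ← Real.exp_add, ← Real.exp_add]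
        refine Real.exp_le_exp.2 ?_
        simp only at h1 ⊢
        linarith
      calc √(u z t) ≤ √(Real.exp (C * l) ^ 2 * u (y (i + 1)) t) := Real.sqrt_le_sqrt h3
        _ = _ := by rw [Real.sqrt_mul (sq_nonneg _), Real.sqrt_sq (Real.exp_nonneg _)]
    · rw [Finset.sum_range_succ]
      exact le_of_eq (by ring)

end ConfRFS

/-- The localized curvature maximized over chains. -/
noncomputable def chainWeight (u : ℂ → ℝ → ℝ) (x₀ : ℂ) (B δ a R : ℝ) (n : ℕ) (y : ℕ → ℂ)
    (t : ℝ) : ℝ :=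
  (t - a) * (max (R - chainEnergy u x₀ B δ n y t) 0 ^ 2 * logSpeed u (y n, t))

/-- The chains with vertices in `K`, starting in a ball about `x₀`. -/
def ChainAdmissible (K : Set (ℂ × ℝ)) (x₀ : ℂ) (r a b : ℝ) (n : ℕ) (y : ℕ → ℂ) (t : ℝ) : Prop :=
  t ∈ Icc a b ∧ ‖y 0 - x₀‖ ≤ r ∧ ∀ i ≤ n, (y i, t) ∈ K

theorem chainEnergy_congr (u : ℂ → ℝ → ℝ) (x₀ : ℂ) (B δ : ℝ) {n : ℕ} {y y' : ℕ → ℂ} (t : ℝ)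
    (h : ∀ i ≤ n, y i = y' i) : chainEnergy u x₀ B δ n y t = chainEnergy u x₀ B δ n y' t := by
  unfold chainEnergy
  rw [h 0 (Nat.zero_le n)]
  congr 1
  refine Finset.sum_congr rfl fun i hi => ?_
  rw [h _ (Finset.mem_range.1 hi), h i (Finset.mem_range.1 hi).le]

/-- The energy of a chain with a point prepended. -/
theorem chainEnergy_cons (u : ℂ → ℝ → ℝ) (x₀ : ℂ) (B δ : ℝ) (n : ℕ) (y : ℕ → ℂ) (t : ℝ) (z : ℂ) :
    chainEnergy u x₀ B δ (n + 1) (fun i => Nat.casesOn i z y) t =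
      chainEnergy u x₀ B δ n y t - B * ‖y 0 - x₀‖ ^ 2 + B * ‖z - x₀‖ ^ 2 +
        (u (y 0) t * ‖y 0 - z‖ ^ 2 / δ + δ) / 2 := by
  unfold chainEnergy
  rw [Finset.sum_range_succ']
  change B * ‖z - x₀‖ ^ 2 + (∑ i ∈ Finset.range n,
    (u (y (i + 1)) t * ‖y (i + 1) - y i‖ ^ 2 / δ + δ) / 2 +
      (u (y 0) t * ‖y 0 - z‖ ^ 2 / δ + δ) / 2) = _
  ring

section

variable {u : ℂ → ℝ → ℝ} {x₀ : ℂ} {B δ t R : ℝ} {n : ℕ} {y : ℕ → ℂ}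

theorem le_chainEnergy (hB : 0 ≤ B) (hδ : 0 < δ) (hu : ∀ i ≤ n, 0 < u (y i) t) :
    n * (δ / 2) ≤ chainEnergy u x₀ B δ n y t := by
  have h1 : ∑ _i ∈ Finset.range n, δ / 2 ≤
      ∑ i ∈ Finset.range n, (u (y (i + 1)) t * ‖y (i + 1) - y i‖ ^ 2 / δ + δ) / 2 := by
    refine Finset.sum_le_sum fun i hi => ?_
    have := hu (i + 1) (Finset.mem_range.1 hi)
    have : 0 ≤ u (y (i + 1)) t * ‖y (i + 1) - y i‖ ^ 2 / δ := by positivity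
    linarith
  rw [Finset.sum_const, Finset.card_range, nsmul_eq_mul] at h1
  have : 0 ≤ B * ‖y 0 - x₀‖ ^ 2 := by positivity
  unfold chainEnergy
  linarith

theorem sum_quadratic_le_chainEnergy (hB : 0 ≤ B) (hδ : 0 < δ) :
    ∑ i ∈ Finset.range n, 1 / (2 * δ) * (‖y (i + 1) - y i‖ ^ 2 * u (y (i + 1)) t) ≤
      chainEnergy u x₀ B δ n y t := by
  have : 0 ≤ B * ‖y 0 - x₀‖ ^ 2 := by positivity
  refine le_trans (Finset.sum_le_sum fun i _ => ?_) (le_add_of_nonneg_left this)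
  have : 1 / (2 * δ) * (‖y (i + 1) - y i‖ ^ 2 * u (y (i + 1)) t) =
    u (y (i + 1)) t * ‖y (i + 1) - y i‖ ^ 2 / δ / 2 := by ring
  rw [this]; linarith

theorem sum_length_le_chainEnergy (hB : 0 ≤ B) (hδ : 0 < δ) (hu : ∀ i ≤ n, 0 < u (y i) t) {k : ℕ}
    (hk : k ≤ n) : ∑ i ∈ Finset.range k, √(u (y (i + 1)) t) * ‖y (i + 1) - y i‖ ≤
      chainEnergy u x₀ B δ n y t := by
  have : 0 ≤ B * ‖y 0 - x₀‖ ^ 2 := by positivity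
  refine le_trans (Finset.sum_le_sum_of_subset_of_nonneg
    (Finset.range_subset_range.2 hk) fun _ _ _ => by positivity) (le_trans
    (Finset.sum_le_sum fun i hi => ?_) (le_add_of_nonneg_left this))
  have hui := hu (i + 1) (Finset.mem_range.1 hi)
  set c := √(u (y (i + 1)) t) * ‖y (i + 1) - y i‖ with hc
  have h1 : u (y (i + 1)) t * ‖y (i + 1) - y i‖ ^ 2 = c ^ 2 := by
    rw [hc, mul_pow, Real.sq_sqrt hui.le]
  rw [h1, le_div_iff₀ two_pos, div_add' _ _ _ hδ.ne', le_div_iff₀ hδ]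
  nlinarith [sq_nonneg (c - δ)]

theorem sum_sq_le (hB : 0 ≤ B) (hδ : 0 < δ) {c : ℝ} (hc : 0 < c) (hu : ∀ i ≤ n, c ≤ u (y i) t)
    (hR : chainEnergy u x₀ B δ n y t ≤ R) :
    ∑ i ∈ Finset.range n, ‖y (i + 1) - y i‖ ^ 2 ≤ 2 * δ * R / c := by
  have h1 := (sum_quadratic_le_chainEnergy (n := n) (y := y) (u := u) (t := t) (x₀ := x₀)
    hB hδ).trans hR
  have h2 : c / (2 * δ) * ∑ i ∈ Finset.range n, ‖y (i + 1) - y i‖ ^ 2 ≤ R := by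
    rw [Finset.mul_sum]
    refine (Finset.sum_le_sum fun i hi => ?_).trans h1
    have hui := hu (i + 1) (Finset.mem_range.1 hi)
    rw [div_eq_mul_one_div c, mul_comm c, mul_assoc]
    refine mul_le_mul_of_nonneg_left ?_ (by positivity)
    rw [mul_comm]
    exact mul_le_mul_of_nonneg_left hui (sq_nonneg _)
  rw [le_div_iff₀ hc]
  rw [div_mul_eq_mul_div, div_le_iff₀ (by positivity)] at h2
  linarith

theorem link_le (hB : 0 ≤ B) (hδ : 0 < δ) {c : ℝ} (hc : 0 < c) (hu : ∀ i ≤ n, c ≤ u (y i) t)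
    (hR : chainEnergy u x₀ B δ n y t ≤ R) {i : ℕ} (hi : i < n) :
    ‖y (i + 1) - y i‖ ≤ √(2 * δ * R / c) :=
  Real.le_sqrt_of_sq_le ((Finset.single_le_sum (f := fun i => ‖y (i + 1) - y i‖ ^ 2)
    (fun _ _ => by positivity) (Finset.mem_range.2 hi)).trans (sum_sq_le hB hδ hc hu hR))

end

namespace ConfRFS

variable {T : ℝ} {M : Set (ℂ × ℝ)} {u : ℂ → ℝ → ℝ} {K : Set (ℂ × ℝ)} {x₀ : ℂ} {B δ a b r R t : ℝ}
  {n : ℕ} {y : ℕ → ℂ}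

/-- The localized curvature attains its maximum over chains. -/
theorem exists_chain_max (h : ConfRFS T M u) (hK : IsCompact K) (hKM : K ⊆ M) (hB : 0 ≤ B)
    (hδ : 0 < δ) (hy : ChainAdmissible K x₀ r a b n y t) :
    ∃ n' y' t', ChainAdmissible K x₀ r a b n' y' t' ∧
      chainWeight u x₀ B δ a R n y t ≤ chainWeight u x₀ B δ a R n' y' t' ∧
      ∀ m w s, ChainAdmissible K x₀ r a b m w s →
        0 < chainWeight u x₀ B δ a R m w s →
        chainWeight u x₀ B δ a R m w s ≤ chainWeight u x₀ B δ a R n' y' t' := by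
  set X : Set ((ℕ → ℂ) × ℝ) :=
    {p | p.2 ∈ Icc a b ∧ ‖p.1 0 - x₀‖ ≤ r ∧ ∀ i, (p.1 i, p.2) ∈ K} with hX
  have hXc : IsCompact X := by
    refine ((isCompact_univ_pi fun _ : ℕ => hK.image continuous_fst).prod
      (isCompact_Icc (a := a) (b := b))).of_isClosed_subset ?_ ?_
    · refine (isClosed_Icc.preimage continuous_snd).inter ((isClosed_le
        (f := fun p : (ℕ → ℂ) × ℝ => ‖p.1 0 - x₀‖) (by fun_prop) continuous_const).inter ?_)
      have : {p : (ℕ → ℂ) × ℝ | ∀ i, (p.1 i, p.2) ∈ K} =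
          ⋂ i, (fun p : (ℕ → ℂ) × ℝ => (p.1 i, p.2)) ⁻¹' K := by
        ext p; simp
      change IsClosed {p : (ℕ → ℂ) × ℝ | ∀ i, (p.1 i, p.2) ∈ K}
      rw [this]
      exact isClosed_iInter fun i => hK.isClosed.preimage (by fun_prop)
    · rintro ⟨w, s⟩ ⟨h1, -, h3⟩
      exact ⟨fun i _ => ⟨_, h3 i, rfl⟩, h1⟩
  have htrunc : ∀ m w s, ChainAdmissible K x₀ r a b m w s →
      ∃ w', (w', s) ∈ X ∧ chainWeight u x₀ B δ a R m w s = chainWeight u x₀ B δ a R m w' s := by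
    rintro m w s ⟨h1, h2, h3⟩
    refine ⟨fun i => w (min i m), ⟨h1, by simpa using h2, fun i => h3 _ (min_le_right _ _)⟩, ?_⟩
    have : ∀ i ≤ m, w i = w (min i m) := fun i hi => by rw [min_eq_left hi]
    unfold chainWeight
    rw [chainEnergy_congr u x₀ B δ s this]
    simp
  have hpair : ∀ i : ℕ, Continuous fun p : (ℕ → ℂ) × ℝ => (p.1 i, p.2) := fun i => by fun_prop
  have hWc : ∀ m, ContinuousOn (fun p : (ℕ → ℂ) × ℝ => chainWeight u x₀ B δ a R m p.1 p.2) X := by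
    intro m
    have hU : ∀ i : ℕ, ContinuousOn (fun p : (ℕ → ℂ) × ℝ => u (p.1 i) p.2) X := fun i =>
      h.smooth.continuousOn.comp (hpair i).continuousOn fun p hp => hKM (hp.2.2 i)
    have hF : ContinuousOn (fun p : (ℕ → ℂ) × ℝ => logSpeed u (p.1 m, p.2)) X :=
      h.contDiffOn_logSpeed.continuousOn.comp (hpair m).continuousOn fun p hp => hKM (hp.2.2 m)
    have hE : ContinuousOn (fun p : (ℕ → ℂ) × ℝ => chainEnergy u x₀ B δ m p.1 p.2) X := by
      unfold chainEnergy
      refine ContinuousOn.add (by fun_prop) (continuousOn_finsetSum _ fun i _ => ?_)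
      exact ((((hU (i + 1)).mul (by fun_prop)).div_const δ).add continuousOn_const).div_const 2
    unfold chainWeight
    exact ContinuousOn.mul (by fun_prop)
      ((((continuousOn_const.sub hE).sup continuousOn_const).pow 2).mul hF)
  obtain ⟨y₁, hy₁, hy₁W⟩ := htrunc n y t hy
  have hmax := fun m => hXc.exists_isMaxOn ⟨_, hy₁⟩ (hWc m)
  choose q hqX hqmax using hmax
  obtain ⟨N, hN⟩ := exists_nat_gt (R / (δ / 2))
  obtain ⟨m₀, hm₀, hbest⟩ := Finset.exists_max_image (Finset.range (max N n + 1))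
    (fun m => chainWeight u x₀ B δ a R m (q m).1 (q m).2) ⟨0, by simp⟩
  refine ⟨m₀, (q m₀).1, (q m₀).2, ⟨(hqX m₀).1, (hqX m₀).2.1, fun i _ => (hqX m₀).2.2 i⟩, ?_, ?_⟩
  · rw [hy₁W]
    exact (hqmax n hy₁).trans (hbest n (Finset.mem_range.2 (by omega)))
  · intro m w s hw hpos
    obtain ⟨w', hw', hW⟩ := htrunc m w s hw
    have hm : m < N := by
      by_contra! hNm
      have h1 := le_chainEnergy (u := u) (x₀ := x₀) (n := m) (y := w) (t := s) hB hδ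
        (fun i hi => h.pos _ (hKM (hw.2.2 i hi)))
      rw [div_lt_iff₀ (by positivity)] at hN
      have h2 : (N:ℝ) ≤ m := by exact_mod_cast hNm
      have h3 : R - chainEnergy u x₀ B δ m w s ≤ 0 := by nlinarith
      rw [chainWeight, max_eq_right h3] at hpos
      simp at hpos
    rw [hW]
    exact (hqmax m hw').trans (hbest m (Finset.mem_range.2 (by omega)))

end ConfRFS

namespace ConfRFS

variable {T : ℝ} {M : Set (ℂ × ℝ)} {u : ℂ → ℝ → ℝ} {K K' : Set (ℂ × ℝ)} {x₀ : ℂ}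
  {B δ a b r R t c₀ A₀ ε C : ℝ} {n : ℕ} {y : ℕ → ℂ}

/-- A maximizing chain starts in the interior of the ball: otherwise prepending a point would
decrease its energy. -/
theorem norm_start_lt (hr : 0 < r) (hδ : 0 < δ) (hc₀ : 0 < c₀)
    (hu : c₀ ≤ u (y 0) t ∧ u (y 0) t ≤ A₀) (hB : √A₀ < B * r) (hδr : δ ≤ √c₀ * r)
    (hsegK : ∀ z ∈ segment ℝ x₀ (y 0), (z, t) ∈ K)
    (hy : ChainAdmissible K x₀ r a b n y t)
    (hmax : ∀ m w s, ChainAdmissible K x₀ r a b m w s → 0 < chainWeight u x₀ B δ a R m w s →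
        chainWeight u x₀ B δ a R m w s ≤ chainWeight u x₀ B δ a R n y t)
    (hat : a < t) (hR : chainEnergy u x₀ B δ n y t < R) (hF : 0 < logSpeed u (y n, t)) :
    ‖y 0 - x₀‖ < r := by
  by_contra! hge
  have hyr : ‖y 0 - x₀‖ = r := le_antisymm hy.2.1 hge
  have hu0 : 0 < u (y 0) t := hc₀.trans_le hu.1
  have hsu : 0 < √(u (y 0) t) := Real.sqrt_pos.2 hu0
  have hBr : √(u (y 0) t) < B * r := (Real.sqrt_le_sqrt hu.2).trans_lt hB
  set θ := δ / (√(u (y 0) t) * r) with hθ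
  have hθ0 : 0 < θ := by positivity
  have hθ1 : θ ≤ 1 := by
    rw [hθ, div_le_one (by positivity)]
    exact hδr.trans (mul_le_mul_of_nonneg_right (Real.sqrt_le_sqrt hu.1) hr.le)
  set z : ℂ := x₀ + (1 - θ) • (y 0 - x₀) with hz
  have hzseg : z ∈ segment ℝ x₀ (y 0) := by
    rw [segment_eq_image']
    exact ⟨1 - θ, ⟨by linarith, by linarith⟩, rfl⟩
  have hzx : ‖z - x₀‖ = (1 - θ) * r := by
    rw [hz, add_sub_cancel_left, norm_smul, hyr, Real.norm_of_nonneg (by linarith)]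
  have hyz : ‖y 0 - z‖ = θ * r := by
    have : y 0 - z = θ • (y 0 - x₀) := by rw [hz, sub_smul, one_smul]; ring
    rw [this, norm_smul, hyr, Real.norm_of_nonneg hθ0.le]
  set w : ℕ → ℂ := fun i => Nat.casesOn i z y with hw
  have hwE : chainEnergy u x₀ B δ (n + 1) w t < chainEnergy u x₀ B δ n y t := by
    rw [hw, chainEnergy_cons, hzx, hyz, hyr]
    have h1 : u (y 0) t * (θ * r) ^ 2 / δ = δ := by
      have h2 : √(u (y 0) t) * (θ * r) = δ := by rw [hθ]; field_simp
      have h3 : u (y 0) t * (θ * r) ^ 2 = δ ^ 2 := by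
        rw [← h2, mul_pow _ (θ * r), Real.sq_sqrt hu0.le]
      rw [h3]; field_simp
    rw [h1]
    have h4 : B * ((1 - θ) * r) ^ 2 ≤ B * r ^ 2 - B * r * (θ * r) := by
      have hB0 : 0 ≤ B * r := hsu.le.trans hBr.le
      nlinarith [mul_nonneg (mul_nonneg hB0 hr.le) (mul_nonneg hθ0.le (sub_nonneg.2 hθ1))]
    have h5 : δ < B * r * (θ * r) := by
      have h2 : √(u (y 0) t) * (θ * r) = δ := by rw [hθ]; field_simp
      calc δ = √(u (y 0) t) * (θ * r) := h2.symm
        _ < _ := by gcongr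
    linarith
  have hwadm : ChainAdmissible K x₀ r a b (n + 1) w t := by
    refine ⟨hy.1, ?_, fun i hi => ?_⟩
    · change ‖z - x₀‖ ≤ r
      rw [hzx]; nlinarith
    · cases i with
      | zero => exact hsegK z hzseg
      | succ i => exact hy.2.2 i (by omega)
  have hlt : chainWeight u x₀ B δ a R n y t < chainWeight u x₀ B δ a R (n + 1) w t := by
    unfold chainWeight
    rw [max_eq_left (by linarith), max_eq_left (by linarith)]
    change _ < (t - a) * ((R - _) ^ 2 * logSpeed u (y n, t))
    have : 0 < t - a := sub_pos.2 hat
    gcongr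
  have hpos : 0 < chainWeight u x₀ B δ a R n y t := by
    unfold chainWeight
    rw [max_eq_left (by linarith)]
    have := sub_pos.2 hat
    have := sub_pos.2 hR
    positivity
  exact absurd (hmax _ _ _ hwadm (hpos.trans hlt)) (not_le.2 hlt)

theorem chainWeight_pos (hpos : 0 < chainWeight u x₀ B δ a R n y t) (hat : a ≤ t) :
    a < t ∧ chainEnergy u x₀ B δ n y t < R ∧ 0 < logSpeed u (y n, t) := by
  unfold chainWeight at hpos
  have h1 := pos_of_mul_pos_right hpos (sub_nonneg.2 hat)
  have h2 := pos_of_mul_pos_right h1 (sq_nonneg _)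
  refine ⟨?_, ?_, h2⟩
  · refine lt_of_le_of_ne hat ?_
    rintro rfl; simp at hpos
  · by_contra! hle
    rw [max_eq_right (by linarith)] at hpos
    simp at hpos

theorem chainWeight_eq (hR : chainEnergy u x₀ B δ n y t < R) : chainWeight u x₀ B δ a R n y t =
    (t - a) * ((R - chainEnergy u x₀ B δ n y t) ^ 2 * logSpeed u (y n, t)) := by
  rw [chainWeight, max_eq_left (by linarith)]

theorem chain_max_space (h : ConfRFS T M u) (hKM : K ⊆ M) (hnhds : ∀ i ≤ n, K ∈ nhds (y i, t))
    (hy : ChainAdmissible K x₀ r a b n y t) (hyr : ‖y 0 - x₀‖ < r)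
    (hmax : ∀ m w s, ChainAdmissible K x₀ r a b m w s → 0 < chainWeight u x₀ B δ a R m w s →
        chainWeight u x₀ B δ a R m w s ≤ chainWeight u x₀ B δ a R n y t)
    (hat : a < t) (hR : chainEnergy u x₀ B δ n y t < R) (hF : 0 < logSpeed u (y n, t)) (d : ℂ) :
    IsLocalMax (fun l : ℝ =>
      (R - chainEnergy u x₀ B δ n (chainVariation u n y t (l * d)) t) ^ 2 *
        logSpeed u (y n + l * d, t)) 0 := by
  have hvar : ∀ i, Continuous fun l : ℝ => chainVariation u n y t (l * d) i := fun i =>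
    (continuous_chainVariation u n y t i).comp (by fun_prop)
  have hv0 : ∀ i, chainVariation u n y t ((0:ℝ) * d) i = y i := fun i => by
    simp [chainVariation_zero]
  have hev1 : ∀ᶠ l : ℝ in nhds 0, ∀ i ∈ Finset.range (n + 1),
      (chainVariation u n y t (l * d) i, t) ∈ K := by
    refine (Filter.eventually_all_finset _).2 fun i hi => ?_
    have : ContinuousAt (fun l : ℝ => (chainVariation u n y t (l * d) i, t)) 0 :=
      ((hvar i).prodMk continuous_const).continuousAt
    refine this.eventually_mem ?_
    have := hnhds i (by simpa [Nat.lt_succ_iff] using hi)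
    rwa [← hv0 i] at this
  have hev2 : ∀ᶠ l : ℝ in nhds 0, ‖chainVariation u n y t (l * d) 0 - x₀‖ < r := by
    refine (((hvar 0).sub continuous_const).norm.continuousAt).eventually_lt continuousAt_const ?_
    rw [← hv0 0] at hyr
    exact hyr
  have hEc := (h.hasJet_chainEnergy (x₀ := x₀) (B := B) (δ := δ)
    (fun i hi => hKM (hy.2.2 i hi)) d).hasDerivAt.continuousAt
  have hev3 : ∀ᶠ l : ℝ in nhds 0,
      chainEnergy u x₀ B δ n (chainVariation u n y t (l * d)) t < R := by
    refine hEc.eventually_lt continuousAt_const ?_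
    simpa [chainVariation_zero] using hR
  have h0 := chainWeight_eq (a := a) hR
  have hpos : 0 < chainWeight u x₀ B δ a R n y t := by
    rw [h0]
    have := sub_pos.2 hat
    have := sub_pos.2 hR
    positivity
  filter_upwards [hev1, hev2, hev3] with l h1 h2 h3
  have hadm : ChainAdmissible K x₀ r a b n (chainVariation u n y t (l * d)) t :=
    ⟨hy.1, h2.le, fun i hi => h1 i (Finset.mem_range.2 (by omega))⟩
  have hW := chainWeight_eq (a := a) h3
  have hle : chainWeight u x₀ B δ a R n (chainVariation u n y t (l * d)) t ≤
      chainWeight u x₀ B δ a R n y t := by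
    by_cases hp : 0 < chainWeight u x₀ B δ a R n (chainVariation u n y t (l * d)) t
    · exact hmax _ _ _ hadm hp
    · exact (not_lt.1 hp).trans hpos.le
  rw [hW, h0, chainVariation_self] at hle
  simpa [chainVariation_zero] using le_of_mul_le_mul_left hle (sub_pos.2 hat)

theorem chain_max_time (h : ConfRFS T M u) (hKM : K ⊆ M) (hnhds : ∀ i ≤ n, K ∈ nhds (y i, t))
    (hy : ChainAdmissible K x₀ r a b n y t)
    (hmax : ∀ m w s, ChainAdmissible K x₀ r a b m w s → 0 < chainWeight u x₀ B δ a R m w s →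
        chainWeight u x₀ B δ a R m w s ≤ chainWeight u x₀ B δ a R n y t)
    (hat : a < t) (hR : chainEnergy u x₀ B δ n y t < R) (hF : 0 < logSpeed u (y n, t)) :
    ∀ᶠ s in nhdsWithin t (Iio t),
      (s - a) * ((R - chainEnergy u x₀ B δ n y s) ^ 2 * logSpeed u (y n, s)) ≤
        (t - a) * ((R - chainEnergy u x₀ B δ n y t) ^ 2 * logSpeed u (y n, t)) := by
  have hev1 : ∀ᶠ s in nhds t, ∀ i ∈ Finset.range (n + 1), (y i, s) ∈ K := by
    refine (Filter.eventually_all_finset _).2 fun i hi => ?_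
    have : ContinuousAt (fun s : ℝ => (y i, s)) t := by fun_prop
    exact this.eventually_mem (hnhds i (by simpa [Nat.lt_succ_iff] using hi))
  have hev2 : ∀ᶠ s in nhds t, a < s := eventually_gt_nhds hat
  have hev3 : ∀ᶠ s in nhds t, chainEnergy u x₀ B δ n y s < R :=
    (h.hasDerivAt_chainEnergy (x₀ := x₀) (B := B) (δ := δ)
      (fun i hi => hKM (hy.2.2 i hi))).continuousAt.eventually_lt continuousAt_const hR
  have h0 := chainWeight_eq (a := a) hR
  have hpos : 0 < chainWeight u x₀ B δ a R n y t := by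
    rw [h0]
    have := sub_pos.2 hat
    have := sub_pos.2 hR
    positivity
  filter_upwards [nhdsWithin_le_nhds hev1, nhdsWithin_le_nhds hev2, nhdsWithin_le_nhds hev3,
    self_mem_nhdsWithin] with s h1 h2 h3 h4
  have hadm : ChainAdmissible K x₀ r a b n y s :=
    ⟨⟨h2.le, (mem_Iio.1 h4).le.trans hy.1.2⟩, hy.2.1,
      fun i hi => h1 i (Finset.mem_range.2 (by omega))⟩
  rw [← chainWeight_eq h3, ← h0]
  by_cases hp : 0 < chainWeight u x₀ B δ a R n y s
  · exact hmax _ _ _ hadm hp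
  · exact (not_lt.1 hp).trans hpos.le

end ConfRFS

namespace ConfRFS

variable {T : ℝ} {M : Set (ℂ × ℝ)} {u : ℂ → ℝ → ℝ} {K K' : Set (ℂ × ℝ)} {x₀ : ℂ}
  {B δ a b r R t c₀ A₀ ε C C' η : ℝ} {n : ℕ} {y : ℕ → ℂ}

/-- The error terms in the maximum principle for chains with short links. -/
theorem chain_error_le (h : ConfRFS T M u) (hC : TaylorBound M u K ε C)
    (hy : ∀ i ≤ n, (y i, t) ∈ K) (h0 : 0 ≤ ε) (hε : ∀ i < n, ‖y (i + 1) - y i‖ ≤ ε)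
    (hCy : ∀ i < n, C * ‖y (i + 1) - y i‖ ≤ 1 / 2) (hB : 0 ≤ B) (hδ : 0 < δ) (hc₀ : 0 < c₀)
    (hu : c₀ ≤ u (y 0) t) (hC' : ∀ p ∈ K, |logSpeed u p| ≤ C')
    (hη : Real.exp ((C + 2 * C ^ 2) * ∑ j ∈ Finset.range n, ‖y (j + 1) - y j‖ ^ 2) - 1 ≤ η)
    (hη1 : η ≤ 1) (hηR : η * C' * R ≤ 1) (hR : chainEnergy u x₀ B δ n y t ≤ R) :
    ‖chainVelocity u n y t 0‖ ^ 2 / u (y n) t ≤ 2 / c₀ ∧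
    ∑ i ∈ Finset.range n, 1 / (2 * δ) *
      (‖y (i + 1) - y i‖ ^ 2 * u (y (i + 1)) t * logSpeed u (y (i + 1), t)) *
        (‖chainVelocity u n y t (i + 1)‖ ^ 2 * u (y (i + 1)) t / u (y n) t - 1) ≤ 1 := by
  have hpos : ∀ i ≤ n, 0 < u (y i) t := fun i hi =>
    h.pos _ (hC.mem _ (hy i hi) (y i) (by simpa using h0))
  have hrat : ∀ i ≤ n, |‖chainVelocity u n y t i‖ ^ 2 * u (y i) t / u (y n) t - 1| ≤ η :=
    fun i hi => (h.chain_ratio hC hy h0 hε hCy hi).trans hη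
  have hη0 : 0 ≤ η := (abs_nonneg _).trans (hrat 0 (Nat.zero_le n))
  have hC'0 : 0 ≤ C' := (abs_nonneg _).trans (hC' _ (hy 0 (Nat.zero_le n)))
  constructor
  · have h1 := (abs_le.1 (hrat 0 (Nat.zero_le n))).2
    rw [le_div_iff₀ hc₀]
    have hP : 0 ≤ ‖chainVelocity u n y t 0‖ ^ 2 / u (y n) t := by
      have := hpos n le_rfl
      positivity
    calc _ ≤ ‖chainVelocity u n y t 0‖ ^ 2 / u (y n) t * u (y 0) t := by gcongr
      _ = ‖chainVelocity u n y t 0‖ ^ 2 * u (y 0) t / u (y n) t := by ring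
      _ ≤ 2 := by linarith
  · have hterm : ∀ i ∈ Finset.range n, 1 / (2 * δ) *
        (‖y (i + 1) - y i‖ ^ 2 * u (y (i + 1)) t * logSpeed u (y (i + 1), t)) *
          (‖chainVelocity u n y t (i + 1)‖ ^ 2 * u (y (i + 1)) t / u (y n) t - 1) ≤
        1 / (2 * δ) * (‖y (i + 1) - y i‖ ^ 2 * u (y (i + 1)) t) * (C' * η) := by
      intro i hi
      have hi' : i + 1 ≤ n := Finset.mem_range.1 hi
      have hq : 0 ≤ 1 / (2 * δ) * (‖y (i + 1) - y i‖ ^ 2 * u (y (i + 1)) t) := by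
        have := hpos _ hi'
        positivity
      have h1 : logSpeed u (y (i + 1), t) *
          (‖chainVelocity u n y t (i + 1)‖ ^ 2 * u (y (i + 1)) t / u (y n) t - 1) ≤ C' * η := by
        refine (le_abs_self _).trans ?_
        rw [abs_mul]
        exact mul_le_mul (hC' _ (hy _ hi')) (hrat _ hi') (abs_nonneg _) hC'0
      calc _ = 1 / (2 * δ) * (‖y (i + 1) - y i‖ ^ 2 * u (y (i + 1)) t) *
            (logSpeed u (y (i + 1), t) *
              (‖chainVelocity u n y t (i + 1)‖ ^ 2 * u (y (i + 1)) t / u (y n) t - 1)) := by ring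
        _ ≤ _ := mul_le_mul_of_nonneg_left h1 hq
    refine (Finset.sum_le_sum hterm).trans ?_
    rw [← Finset.sum_mul]
    calc _ ≤ R * (C' * η) := mul_le_mul_of_nonneg_right
          ((sum_quadratic_le_chainEnergy hB hδ).trans hR) (by positivity)
      _ = η * C' * R := by ring
      _ ≤ 1 := hηR

/-- The localized curvature is bounded at a maximizing chain with short links. -/
theorem chainWeight_max_le (h : ConfRFS T M u) (hC : TaylorBound M u K ε C) (hKM : K ⊆ M)
    (hnhds : ∀ i ≤ n, K ∈ nhds (y i, t)) (hy : ChainAdmissible K x₀ r a b n y t)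
    (hmax : ∀ m w s, ChainAdmissible K x₀ r a b m w s → 0 < chainWeight u x₀ B δ a R m w s →
        chainWeight u x₀ B δ a R m w s ≤ chainWeight u x₀ B δ a R n y t)
    (hat : a < t) (hR : chainEnergy u x₀ B δ n y t < R) (hF : 0 < logSpeed u (y n, t))
    (h0 : 0 ≤ ε) (hε : ∀ i < n, ‖y (i + 1) - y i‖ ≤ ε)
    (hCy : ∀ i < n, C * ‖y (i + 1) - y i‖ ≤ 1 / 2) (hr : 0 < r) (hδ : 0 < δ) (hc₀ : 0 < c₀)
    (hu : c₀ ≤ u (y 0) t ∧ u (y 0) t ≤ A₀) (hB : √A₀ < B * r) (hδr : δ ≤ √c₀ * r)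
    (hsegK : ∀ z ∈ segment ℝ x₀ (y 0), (z, t) ∈ K) (hC' : ∀ p ∈ K, |logSpeed u p| ≤ C')
    (hη : Real.exp ((C + 2 * C ^ 2) * ∑ j ∈ Finset.range n, ‖y (j + 1) - y j‖ ^ 2) - 1 ≤ η)
    (hη1 : η ≤ 1) (hηR : η * C' * R ≤ 1) :
    chainWeight u x₀ B δ a R n y t ≤
      R ^ 2 + (b - a) * (2 * R * (8 * B / c₀ + 1) + 48 * B ^ 2 * r ^ 2 / c₀) := by
  have hyr := norm_start_lt hr hδ hc₀ hu hB hδr hsegK hy hmax hat hR hF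
  have hB0 : 0 ≤ B := (pos_of_mul_pos_left ((Real.sqrt_nonneg _).trans_lt hB) hr.le).le
  have hpos : ∀ i ≤ n, 0 < u (y i) t := fun i hi => h.pos _ (hKM (hy.2.2 i hi))
  have he0 : 0 ≤ chainEnergy u x₀ B δ n y t :=
    le_trans (by positivity) (le_chainEnergy hB0 hδ hpos)
  obtain ⟨hP, hS⟩ := h.chain_error_le (R := R) hC hy.2.2 h0 hε hCy hB0 hδ hc₀ hu.1 hC' hη hη1
    hηR hR.le
  have key := h.localized_max_le (fun i hi => hKM (hy.2.2 i hi)) hat hR hF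
    (h.chain_max_space hKM hnhds hy hyr hmax hat hR hF)
    (h.chain_max_time hKM hnhds hy hmax hat hR hF)
  rw [chainWeight_eq hR]
  refine key.trans ?_
  set e := chainEnergy u x₀ B δ n y t
  have h1 : (R - e) ^ 2 ≤ R ^ 2 := by nlinarith
  have h2 : 4 * B * ‖chainVelocity u n y t 0‖ ^ 2 / u (y n) t ≤ 8 * B / c₀ := by
    calc _ = 4 * B * (‖chainVelocity u n y t 0‖ ^ 2 / u (y n) t) := by ring
      _ ≤ 4 * B * (2 / c₀) := by gcongr
      _ = _ := by ring
  have h3 : 24 * B ^ 2 * ‖y 0 - x₀‖ ^ 2 * ‖chainVelocity u n y t 0‖ ^ 2 / u (y n) t ≤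
      48 * B ^ 2 * r ^ 2 / c₀ := by
    have := hpos n le_rfl
    calc _ = 24 * B ^ 2 * ‖y 0 - x₀‖ ^ 2 * (‖chainVelocity u n y t 0‖ ^ 2 / u (y n) t) := by ring
      _ ≤ 24 * B ^ 2 * r ^ 2 * (2 / c₀) := by gcongr
      _ = _ := by ring
  refine add_le_add h1 ?_
  have hX : 0 ≤ 8 * B / c₀ + 1 := by positivity
  have hY : 0 ≤ 48 * B ^ 2 * r ^ 2 / c₀ := by positivity
  have hRe : 0 ≤ 2 * (R - e) := by linarith
  have hR0 : 0 ≤ R := he0.trans hR.le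
  calc _ ≤ (t - a) * (2 * (R - e) * (8 * B / c₀ + 1) + 48 * B ^ 2 * r ^ 2 / c₀) := by
        have := sub_pos.2 hat
        gcongr
    _ ≤ (t - a) * (2 * R * (8 * B / c₀ + 1) + 48 * B ^ 2 * r ^ 2 / c₀) := by
        have := sub_pos.2 hat
        gcongr
        linarith
    _ ≤ _ := by
        have := hy.1.2
        gcongr

end ConfRFS

theorem exists_closedBall_tube {M : Set (ℂ × ℝ)} (hM : IsOpen M) {x₀ : ℂ} {a b : ℝ}
    (hx : ∀ t ∈ Icc a b, (x₀, t) ∈ M) :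
    ∃ r > 0, ∀ z ∈ closedBall x₀ r, ∀ t ∈ Icc a b, (z, t) ∈ M := by
  have hS : IsCompact (({x₀} : Set ℂ) ×ˢ Icc a b) := isCompact_singleton.prod isCompact_Icc
  obtain ⟨r, hr, hrM⟩ := hS.exists_cthickening_subset_open hM
    (fun p hp => by rcases p with ⟨z, t⟩; obtain ⟨rfl, ht⟩ := hp; exact hx t ht)
  refine ⟨r, hr, fun z hz t ht => hrM ?_⟩
  refine mem_cthickening_of_dist_le (z, t) (x₀, t) _ _ ⟨rfl, ht⟩ ?_
  rw [Prod.dist_eq, dist_self]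
  exact max_le hz hr.le

theorem exists_link_length {ε c₁ δ₀ : ℝ} (hε : 0 < ε) (hδ₀ : 0 < δ₀) (C C' R : ℝ) :
    ∃ δ > 0, δ ≤ δ₀ ∧ √(2 * δ * R / c₁) ≤ ε ∧ C * √(2 * δ * R / c₁) ≤ 1 / 2 ∧
      Real.exp (C * √(2 * δ * R / c₁)) * R ≤ R + 1 ∧
      Real.exp ((C + 2 * C ^ 2) * (2 * δ * R / c₁)) - 1 ≤ 1 ∧
      (Real.exp ((C + 2 * C ^ 2) * (2 * δ * R / c₁)) - 1) * C' * R ≤ 1 := by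
  have key : ∀ (f : ℝ → ℝ) (c : ℝ), Continuous f → f 0 < c →
      ∀ᶠ δ in nhdsWithin (0:ℝ) (Ioi 0), f δ ≤ c := fun f c hf h0 =>
    nhdsWithin_le_nhds ((hf.continuousAt.eventually_lt continuousAt_const h0).mono fun _ h => h.le)
  obtain ⟨δ, h⟩ := ((((((key (fun δ => δ) δ₀ (by fun_prop) hδ₀).and
    (key (fun δ => √(2 * δ * R / c₁)) ε (by fun_prop) (by simpa))).and
    (key (fun δ => C * √(2 * δ * R / c₁)) (1 / 2) (by fun_prop) (by simp))).and
    (key (fun δ => Real.exp (C * √(2 * δ * R / c₁)) * R) (R + 1) (by fun_prop) (by simp))).and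
    (key (fun δ => Real.exp ((C + 2 * C ^ 2) * (2 * δ * R / c₁)) - 1) 1 (by fun_prop)
      (by simp))).and
    ((key (fun δ => (Real.exp ((C + 2 * C ^ 2) * (2 * δ * R / c₁)) - 1) * C' * R) 1 (by fun_prop)
      (by simp)).and self_mem_nhdsWithin)).exists
  exact ⟨δ, h.2.2, h.1.1.1.1.1, h.1.1.1.1.2, h.1.1.1.2, h.1.1.2, h.1.2, h.2.1⟩

theorem exists_pos_quadratic_le (X Y τ : ℝ) : ∃ R > 0, τ * (2 * R * X + Y) ≤ R ^ 2 := by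
  refine ⟨2 * |τ * X| + |τ * Y| + 1, by positivity, ?_⟩
  set R := 2 * |τ * X| + |τ * Y| + 1
  have h1 := le_abs_self (τ * X)
  have h2 := le_abs_self (τ * Y)
  have hR1 : 1 ≤ R := by
    have := abs_nonneg (τ * X); have := abs_nonneg (τ * Y); simp only [R]; linarith
  calc τ * (2 * R * X + Y) = 2 * R * (τ * X) + τ * Y := by ring
    _ ≤ 2 * R * |τ * X| + R * |τ * Y| := by
        have : |τ * Y| ≤ R * |τ * Y| := le_mul_of_one_le_left (abs_nonneg _) hR1
        have : 2 * R * (τ * X) ≤ 2 * R * |τ * X| := by gcongr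
        linarith
    _ ≤ R ^ 2 := by simp only [R]; nlinarith

theorem chainWeight_zero (u : ℂ → ℝ → ℝ) (x₀ : ℂ) (B δ a : ℝ) {R : ℝ} (hR : 0 < R) (t : ℝ) :
    chainWeight u x₀ B δ a R 0 (fun _ => x₀) t = (t - a) * (R ^ 2 * logSpeed u (x₀, t)) := by
  have : chainEnergy u x₀ B δ 0 (fun _ => x₀) t = 0 := by simp [chainEnergy]
  rw [chainWeight, this, sub_zero, max_eq_left hR.le]

namespace ConfRFS

variable {T : ℝ} {M : Set (ℂ × ℝ)} {u : ℂ → ℝ → ℝ} {x₀ : ℂ} {a b : ℝ}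

/-- The lower curvature bound `K ≥ -1 / t` of a complete, spatially connected Ricci flow. -/
theorem mul_logSpeed_le_two (h : ConfRFS T M u) (hcomp : ConfRFSComplete T M u)
    (hconn : ∀ t ∈ Ioo (0:ℝ) T, IsConnected (timeSlice M t)) (ha : 0 < a) (hab : a < b)
    (hb : b < T) (hx : ∀ t ∈ Icc a b, (x₀, t) ∈ M) : (b - a) * logSpeed u (x₀, b) ≤ 2 := by
  by_contra! hcon
  have hIoo : ∀ t ∈ Icc a b, t ∈ Ioo (0:ℝ) T := fun t ht => ⟨ha.trans_le ht.1, ht.2.trans_lt hb⟩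
  have hbb : b ∈ Icc a b := ⟨hab.le, le_rfl⟩
  have hucont := h.smooth.continuousOn
  obtain ⟨r, hr, hrM⟩ := exists_closedBall_tube h.opn hx
  have hQ : IsCompact (closedBall x₀ r ×ˢ Icc a b) :=
    (isCompact_closedBall _ _).prod isCompact_Icc
  have hQM : closedBall x₀ r ×ˢ Icc a b ⊆ M := fun p hp => hrM p.1 hp.1 p.2 hp.2
  have hQne : (closedBall x₀ r ×ˢ Icc a b).Nonempty := ⟨(x₀, b), mem_closedBall_self hr.le, hbb⟩
  obtain ⟨pmin, hpmin, hmin⟩ := hQ.exists_isMinOn hQne (hucont.mono hQM)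
  obtain ⟨pmax, -, hpmax⟩ := hQ.exists_isMaxOn hQne (hucont.mono hQM)
  set c₀ := u pmin.1 pmin.2
  set A₀ := u pmax.1 pmax.2
  have hc₀ : 0 < c₀ := h.pos _ (hQM hpmin)
  set B := (√A₀ + 1) / r with hBdef
  have hBr : √A₀ < B * r := by rw [hBdef, div_mul_cancel₀ _ hr.ne']; linarith
  have hB0 : 0 ≤ B := by positivity
  obtain ⟨R, hR, hRle⟩ := exists_pos_quadratic_le (8 * B / c₀ + 1) (48 * B ^ 2 * r ^ 2 / c₀) (b - a)
  obtain ⟨K', hK'M, hK', hreach⟩ := exists_compact_reach_slab h.opn hucont h.pos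
    (isCompact_closedBall x₀ r) hrM (fun t ht => hcomp t (hIoo t ht))
    (fun t ht => hconn t (hIoo t ht)) (R + 1)
  have hQK' : ∀ z ∈ closedBall x₀ r, ∀ t ∈ Icc a b, (z, t) ∈ K' := fun z hz t ht =>
    hreach t ht z (.start hz (by linarith))
  obtain ⟨ε₀, hε₀, hε₀M⟩ := hK'.exists_cthickening_subset_open h.opn hK'M
  set ε := ε₀ / 2 with hεdef
  have hε : 0 < ε := half_pos hε₀
  set K := cthickening ε K'
  have hKc : IsCompact K := hK'.cthickening
  have hKsub : K ⊆ cthickening ε₀ K' := cthickening_mono (by linarith) _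
  have hKM : K ⊆ M := hKsub.trans hε₀M
  have hKne : K.Nonempty :=
    ⟨_, self_subset_cthickening _ (hQK' x₀ (mem_closedBall_self hr.le) b hbb)⟩
  obtain ⟨C, hC⟩ := h.exists_taylorBound (K := K) (hK'.cthickening (r := ε₀)) hε₀M hε
    (fun p hp z hz => by
      have h1 : (z, p.2) ∈ cthickening ε K := by
        refine mem_cthickening_of_dist_le _ p _ _ hp ?_
        rw [Prod.dist_eq, dist_self, dist_eq_norm]
        exact max_le hz hε.le
      have := cthickening_cthickening_subset hε.le hε.le K' h1
      rwa [hεdef, add_halves] at this)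
  obtain ⟨q, hqK, hq⟩ := hKc.exists_isMinOn hKne (hucont.mono hKM)
  have hc₁ : 0 < u q.1 q.2 := h.pos _ (hKM hqK)
  set c₁ := u q.1 q.2
  obtain ⟨C', hC'⟩ := hKc.exists_bound_of_continuousOn
    (h.contDiffOn_logSpeed.continuousOn.mono hKM)
  have hC'0 : 0 ≤ C' := (norm_nonneg _).trans (hC' _ hqK)
  obtain ⟨δ, hδ, hδr, hl, hCl, hexp, hη1, hηR⟩ := exists_link_length (c₁ := c₁) hε
    (δ₀ := √c₀ * r) (by positivity) C C' R
  have hstart : ChainAdmissible K x₀ r a b 0 (fun _ => x₀) b :=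
    ⟨hbb, by simpa using hr.le, fun _ _ =>
      self_subset_cthickening _ (hQK' x₀ (mem_closedBall_self hr.le) b hbb)⟩
  obtain ⟨n, y, t, hy, hle, hmax⟩ := h.exists_chain_max (R := R) hKc hKM hB0 hδ hstart
  rw [chainWeight_zero u x₀ B δ a hR] at hle
  have hbig : 2 * R ^ 2 < (b - a) * (R ^ 2 * logSpeed u (x₀, b)) := by
    nlinarith [pow_pos hR 2]
  have hW : 0 < chainWeight u x₀ B δ a R n y t :=
    (by positivity : 0 < 2 * R ^ 2).trans (hbig.trans_le hle)
  obtain ⟨hat, heR, hF⟩ := chainWeight_pos hW hy.1.1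
  have hpos : ∀ i ≤ n, 0 < u (y i) t := fun i hi => h.pos _ (hKM (hy.2.2 i hi))
  have hc₁u : ∀ i ≤ n, c₁ ≤ u (y i) t := fun i hi => hq (hy.2.2 i hi)
  have hlink : ∀ i < n, ‖y (i + 1) - y i‖ ≤ √(2 * δ * R / c₁) := fun i hi =>
    link_le hB0 hδ hc₁ hc₁u heR.le hi
  have hy0 : y 0 ∈ closedBall x₀ r := mem_closedBall_iff_norm.2 hy.2.1
  have hyK' : ∀ i ≤ n, (y i, t) ∈ K' := fun i hi => by
    refine hreach t hy.1 _ ((h.chain_reach hC hy.2.2 hl hlink hy0 i hi).mono ?_)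
    refine le_trans ?_ hexp
    gcongr
    exact (sum_length_le_chainEnergy hB0 hδ hpos hi).trans heR.le
  have hnhds : ∀ i ≤ n, K ∈ nhds (y i, t) := fun i hi =>
    mem_of_superset (closedBall_mem_nhds _ hε) (closedBall_subset_cthickening (hyK' i hi) ε)
  have hsegK : ∀ z ∈ segment ℝ x₀ (y 0), (z, t) ∈ K := fun z hz =>
    self_subset_cthickening _ (hQK' z ((convex_closedBall x₀ r).segment_subset
      (mem_closedBall_self hr.le) hy0 hz) t hy.1)
  have hfin := h.chainWeight_max_le (η := Real.exp ((C + 2 * C ^ 2) * (2 * δ * R / c₁)) - 1)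
    hC hKM hnhds hy hmax hat heR hF hε.le
    (fun i hi => (hlink i hi).trans hl)
    (fun i hi => (mul_le_mul_of_nonneg_left (hlink i hi) hC.nonneg).trans hCl) hr hδ hc₀
    ⟨hmin (show ((y 0, t) : ℂ × ℝ) ∈ closedBall x₀ r ×ˢ Icc a b from ⟨hy0, hy.1⟩),
      hpmax (show ((y 0, t) : ℂ × ℝ) ∈ closedBall x₀ r ×ˢ Icc a b from ⟨hy0, hy.1⟩)⟩
    hBr hδr hsegK hC' (by
      have := hC.nonneg
      gcongr
      exact sum_sq_le hB0 hδ hc₁ hc₁u heR.le) hη1 hηR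
  linarith

end ConfRFS

/-- In a complete conformal metric, a straight path on which the conformal factor is bounded ends
inside the domain. -/
theorem ConfComplete.mem_of_segment {v : ℂ → ℝ} {Ω : Set ℂ} (hcomp : ConfComplete v Ω)
    (hΩ : IsOpen Ω) (hv : ContinuousOn v Ω) (hpos : ∀ z ∈ Ω, 0 < v z) (hconn : IsConnected Ω)
    {p q : ℂ} {m : ℝ}
    (hm : ∀ l ∈ Ico (0:ℝ) 1, AffineMap.lineMap p q l ∈ Ω ∧ √(v (AffineMap.lineMap p q l)) ≤ m) :
    q ∈ Ω := by
  set s : ℕ → ℝ := fun n => 1 - 1 / ((n : ℝ) + 1) with hs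
  have hs1 : ∀ n, s n ∈ Ico (0:ℝ) 1 := fun n => by
    have h1 : 1 / ((n : ℝ) + 1) ≤ 1 := by
      rw [div_le_one (by positivity)]; linarith [n.cast_nonneg (α := ℝ)]
    have h2 : 0 < 1 / ((n : ℝ) + 1) := by positivity
    exact ⟨by simp only [hs]; linarith, by simp only [hs]; linarith⟩
  set x : ℕ → ℂ := fun n => AffineMap.lineMap p q (s n) with hx
  have hst : Tendsto s atTop (nhds 1) := by
    have := (tendsto_const_nhds (x := (1:ℝ))).sub
      (tendsto_one_div_add_atTop_nhds_zero_nat (𝕜 := ℝ))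
    rwa [sub_zero] at this
  have hxt : Tendsto x atTop (nhds q) := by
    have := ((AffineMap.lineMap_continuous (R := ℝ) (p := p) (q := q)).tendsto 1).comp hst
    rwa [AffineMap.lineMap_apply_one] at this
  have hm0 : 0 ≤ m := (Real.sqrt_nonneg _).trans (hm 0 (by simp)).2
  have hreach : ∀ i j, Reach v Ω {x i} (m * ‖x j - x i‖) (x j) := fun i j => by
    refine Reach.edge fun z hz => ?_
    rw [hx, ← image_segment] at hz
    obtain ⟨l, hl, rfl⟩ := hz
    exact hm l ((convex_Ico 0 1).segment_subset (hs1 i) (hs1 j) hl)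
  obtain ⟨l, hl, hxl⟩ := hcomp.exists_tendsto hΩ hv hpos hconn (x := x)
    (fun n => (hm _ (hs1 n)).1) (fun ε hε => by
      obtain ⟨N, hN⟩ := Metric.cauchySeq_iff.1 hxt.cauchySeq (ε / (m + 1)) (by positivity)
      refine ⟨N, fun i hi j hj => ⟨_, ?_, hreach i j⟩⟩
      have := hN j hj i hi
      rw [dist_eq_norm, lt_div_iff₀ (by positivity)] at this
      nlinarith [norm_nonneg (x j - x i)])
  rwa [tendsto_nhds_unique hxt hxl]

namespace ConfRFS

variable {T : ℝ} {M : Set (ℂ × ℝ)} {u : ℂ → ℝ → ℝ} {x : ℂ} {a s τ : ℝ}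

theorem factor_le_mul_exp (h : ConfRFS T M u) (hcomp : ConfRFSComplete T M u)
    (hconn : ∀ t ∈ Ioo (0:ℝ) T, IsConnected (timeSlice M t)) (ha : 0 < a) (has : a < s)
    (hsτ : s ≤ τ) (hτ : τ < T) (hx : ∀ t ∈ Icc a τ, (x, t) ∈ M) :
    u x τ ≤ u x s * Real.exp (2 / (s - a) * (τ - s)) := by
  have hd : ∀ t ∈ Icc s τ, HasDerivAt (fun t => Real.log (u x t)) (logSpeed u (x, t)) t :=
    fun t ht => by
      have hM := hx t ⟨has.le.trans ht.1, ht.2⟩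
      have h0 := (h.pos _ hM).ne'
      simpa [mul_div_cancel_left₀ _ h0] using (h.hasDerivAt_time hM).log h0
  have hF : ∀ t ∈ Icc s τ, logSpeed u (x, t) ≤ 2 / (s - a) := fun t ht => by
    have hat : a < t := has.trans_le ht.1
    have h1 := h.mul_logSpeed_le_two hcomp hconn ha hat (ht.2.trans_lt hτ)
      (fun r hr => hx r ⟨hr.1, hr.2.trans ht.2⟩)
    calc logSpeed u (x, t) ≤ 2 / (t - a) := by
          rw [le_div_iff₀ (sub_pos.2 hat)]; linarith
      _ ≤ 2 / (s - a) := by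
          have := sub_pos.2 has
          have := ht.1
          gcongr
  have hsub : ∀ t ∈ interior (Icc s τ), t ∈ Icc s τ := fun t ht => interior_subset ht
  have key := (convex_Icc s τ).image_sub_le_mul_sub_of_deriv_le
    (fun t ht => (hd t ht).continuousAt.continuousWithinAt)
    (fun t ht => (hd t (hsub t ht)).differentiableAt.differentiableWithinAt)
    (C := 2 / (s - a)) (fun t ht => by rw [(hd t (hsub t ht)).deriv]; exact hF t (hsub t ht))
    s ⟨le_rfl, hsτ⟩ τ ⟨hsτ, le_rfl⟩ hsτ
  have hs0 : 0 < u x s := h.pos _ (hx s ⟨has.le, hsτ⟩)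
  have hτ0 : 0 < u x τ := h.pos _ (hx τ ⟨has.le.trans hsτ, le_rfl⟩)
  calc u x τ = Real.exp (Real.log (u x τ)) := (Real.exp_log hτ0).symm
    _ ≤ Real.exp (Real.log (u x s) + 2 / (s - a) * (τ - s)) := Real.exp_le_exp.2 (by linarith)
    _ = _ := by rw [Real.exp_add, Real.exp_log hs0]

/-- A point of the slice at time `s` near which some worldlines survive until time `τ` and some do
not. -/
theorem exists_boundary_point (h : ConfRFS T M u) {z w : ℂ}
    (hconn : IsConnected (timeSlice M s)) (hsτ : s ≤ τ) (hz : (z, s) ∈ M)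
    (hz' : ¬ ∀ t ∈ Icc s τ, (z, t) ∈ M) (hw : ∀ t ∈ Icc s τ, (w, t) ∈ M) :
    ∃ x, (x, s) ∈ M ∧ (¬ ∀ t ∈ Icc s τ, (x, t) ∈ M) ∧
      ∀ r > 0, ∃ p ∈ ball x r, ∀ t ∈ Icc s τ, (p, t) ∈ M := by
  set U : Set ℂ := {x | ∀ t ∈ Icc s τ, (x, t) ∈ M} with hU
  have hUo : IsOpen U := by
    rw [Metric.isOpen_iff]
    intro x hx
    obtain ⟨r, hr, hrM⟩ := exists_closedBall_tube h.opn hx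
    exact ⟨r, hr, fun y hy => hrM y (ball_subset_closedBall hy)⟩
  by_contra! hcon
  refine hz' (hconn.isPreconnected.subset_of_closure_inter_subset hUo
    ⟨w, hw s ⟨le_rfl, hsτ⟩, hw⟩ (fun x hx => ?_) hz)
  by_contra hxU
  obtain ⟨r, hr, hrU⟩ := hcon x hx.2 (not_forall₂.1 hxU |>.imp fun _ ⟨h1, h2⟩ => ⟨h1, h2⟩)
  obtain ⟨p, hp, hpx⟩ := Metric.mem_closure_iff.1 hx.1 r hr
  obtain ⟨t, ht, htM⟩ := hrU p (by rwa [mem_ball, dist_comm])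
  exact htM (hp t ht)

/-- Worldlines near `x` cannot become singular while a nearby worldline survives. -/
theorem persists_of_near (h : ConfRFS T M u) (hcomp : ConfRFSComplete T M u)
    (hconn : ∀ t ∈ Ioo (0:ℝ) T, IsConnected (timeSlice M t)) (ha : 0 < a) (has : a < s)
    (hτ : τ < T) {r : ℝ} (hD : ∀ z ∈ closedBall x r, ∀ t ∈ Icc a s, (z, t) ∈ M) {p q : ℂ}
    (hp : p ∈ closedBall x r) (hpM : ∀ t ∈ Icc s τ, (p, t) ∈ M) (hq : q ∈ closedBall x r) :
    ∀ t ∈ Icc s τ, (q, t) ∈ M := by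
  set γ : ℝ → ℂ := ⇑(AffineMap.lineMap (k := ℝ) p q) with hγ
  have hγc : Continuous γ := AffineMap.lineMap_continuous
  have hγD : ∀ l ∈ Icc (0:ℝ) 1, γ l ∈ closedBall x r := fun l hl =>
    (convex_closedBall x r).segment_subset hp hq (by
      rw [segment_eq_image_lineMap]; exact ⟨l, hl, rfl⟩)
  by_contra hcon
  set S : Set ℝ := {l | l ∈ Icc (0:ℝ) 1 ∧ ¬ ∀ t ∈ Icc s τ, (γ l, t) ∈ M} with hS
  have hSc : IsClosed S := by
    have hUo : IsOpen {l : ℝ | ∀ t ∈ Icc s τ, (γ l, t) ∈ M} := by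
      rw [isOpen_iff_mem_nhds]
      intro l hl
      obtain ⟨ρ, hρ, hρM⟩ := exists_closedBall_tube h.opn hl
      filter_upwards [hγc.continuousAt.eventually_mem (closedBall_mem_nhds (γ l) hρ)] with k hk
      exact hρM _ hk
    exact isClosed_Icc.inter hUo.isClosed_compl
  have hSne : S.Nonempty := ⟨1, by simp, by simpa [hγ] using hcon⟩
  have hSb : BddBelow S := ⟨0, fun l hl => hl.1.1⟩
  obtain ⟨hl₀, hl₀M⟩ := hSc.csInf_mem hSne hSb
  set l₀ := sInf S
  have hbefore : ∀ l ∈ Ico 0 l₀, ∀ t ∈ Icc s τ, (γ l, t) ∈ M := fun l hl => by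
    by_contra hl'
    exact absurd (csInf_le hSb ⟨⟨hl.1, hl.2.le.trans hl₀.2⟩, hl'⟩) (not_le.2 hl.2)
  have hl₀pos : 0 < l₀ := by
    refine lt_of_le_of_ne hl₀.1 fun h0 => hl₀M ?_
    rw [← h0]; simpa [hγ] using hpM
  push Not at hl₀M
  obtain ⟨t, ht, htM⟩ := hl₀M
  have ht0 : t ∈ Ioo (0:ℝ) T := ⟨ha.trans (has.trans_le ht.1), ht.2.trans_lt hτ⟩
  have hDs : IsCompact (closedBall x r) := isCompact_closedBall _ _
  obtain ⟨A, hA⟩ := hDs.exists_bound_of_continuousOn (f := fun z => u z s)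
    (h.smooth.continuousOn.comp (f := fun z : ℂ => (z, s)) (by fun_prop)
      fun z hz => hD z hz s ⟨has.le, le_rfl⟩)
  have hslice : Continuous fun z : ℂ => (z, t) := by fun_prop
  refine htM ((hcomp t ht0).mem_of_segment (h.opn.preimage hslice)
    (h.smooth.continuousOn.comp hslice.continuousOn fun z hz => hz) (fun z hz => h.pos _ hz)
    (hconn t ht0) (p := p) (m := √(A * Real.exp (2 / (s - a) * (t - s)))) fun l hl => ?_)
  have heq : AffineMap.lineMap p (γ l₀) l = γ (l₀ * l) := by
    simp only [hγ, AffineMap.lineMap_apply, vsub_eq_sub, vadd_eq_add, add_sub_cancel_right,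
      smul_smul, mul_comm l₀ l]
  have hll : l₀ * l ∈ Ico 0 l₀ := ⟨mul_nonneg hl₀.1 hl.1, mul_lt_of_lt_one_right hl₀pos hl.2⟩
  have hllD : γ (l₀ * l) ∈ closedBall x r := hγD _ ⟨hll.1, hll.2.le.trans hl₀.2⟩
  rw [heq]
  refine ⟨hbefore _ hll t ht, Real.sqrt_le_sqrt ?_⟩
  refine (h.factor_le_mul_exp hcomp hconn ha has ht.1 ht0.2 fun k hk => ?_).trans ?_
  · rcases le_total k s with hks | hks
    · exact hD _ hllD k ⟨hk.1, hks⟩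
    · exact hbefore _ hll k ⟨hks, hk.2.trans ht.2⟩
  · gcongr
    exact (le_abs_self _).trans (hA _ hllD)

end ConfRFS

/-- A complete, spatially-connected conformal Ricci flow spacetime in `ℂ × (0,T)`
is expanding. -/
theorem complete_spatially_connected_spacetime_expanding
    (T : ℝ) (hT : 0 < T) (M : Set (ℂ × ℝ)) (u : ℂ → ℝ → ℝ)
    (hRF : ConfRFS T M u) (hcomp : ConfRFSComplete T M u)
    (hsc : ∀ t ∈ Ioo (0:ℝ) T, IsConnected (timeSlice M t)) :
    ∀ (z : ℂ) (t t' : ℝ), (z, t) ∈ M → t ≤ t' → t' < T → (z, t') ∈ M := by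
  intro z t t' hz htt' ht'
  by_contra hcon
  have ht0 : 0 < t := (hRF.sub hz).1
  set S : Set ℝ := Icc t t' ∩ {r | (z, r) ∉ M} with hS
  have hline : ∀ x : ℂ, IsOpen {r : ℝ | (x, r) ∈ M} := fun x =>
    hRF.opn.preimage (f := fun r : ℝ => (x, r)) (by fun_prop)
  have hSc : IsClosed S := isClosed_Icc.inter (hline z).isClosed_compl
  have hSb : BddBelow S := ⟨t, fun r hr => hr.1.1⟩
  obtain ⟨hτ, hτM⟩ := hSc.csInf_mem ⟨t', ⟨htt', le_rfl⟩, hcon⟩ hSb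
  set τ := sInf S
  have hbefore : ∀ r ∈ Ico t τ, (z, r) ∈ M := fun r hr => by
    by_contra hr'
    exact absurd (csInf_le hSb ⟨⟨hr.1, hr.2.le.trans hτ.2⟩, hr'⟩) (not_le.2 hr.2)
  have htτ : t < τ := lt_of_le_of_ne hτ.1 fun h0 => hτM (by rwa [← h0])
  have hτT : τ < T := hτ.2.trans_lt ht'
  obtain ⟨w, hw⟩ := hRF.nonempty τ ⟨ht0.trans htτ, hτT⟩
  obtain ⟨l, hl, hlM⟩ := exists_Ioc_subset_of_mem_nhds ((hline w).mem_nhds hw) ⟨t, htτ⟩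
  obtain ⟨s, hs1, hs2⟩ := exists_between (max_lt hl htτ)
  have hts : t < s := (le_max_right _ _).trans_lt hs1
  obtain ⟨x, hxM, hx, hnear⟩ := hRF.exists_boundary_point (hsc s ⟨ht0.trans hts, hs2.trans hτT⟩)
    hs2.le (hbefore s ⟨hts.le, hs2⟩) (fun hzs => hτM (hzs τ ⟨hs2.le, le_rfl⟩))
    (fun r hr => hlM ⟨((le_max_left _ _).trans_lt hs1).trans_le hr.1, hr.2⟩)
  obtain ⟨k, hk, hkM⟩ := exists_Ioc_subset_of_mem_nhds ((hline x).mem_nhds hxM) ⟨t, hts⟩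
  obtain ⟨a, ha1, ha2⟩ := exists_between (max_lt hk hts)
  have hta : t < a := (le_max_right _ _).trans_lt ha1
  obtain ⟨r, hr, hrM⟩ := exists_closedBall_tube hRF.opn (x₀ := x) (a := a) (b := s)
    (fun i hi => hkM ⟨((le_max_left _ _).trans_lt ha1).trans_le hi.1, hi.2⟩)
  obtain ⟨p, hp, hpM⟩ := hnear r hr
  exact hx (hRF.persists_of_near hcomp hsc (ht0.trans hta) ha2 hτT hrM
    (ball_subset_closedBall hp) hpM (mem_closedBall_self hr.le))
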